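/- arXiv:1210.1435 — 3 statements merged into one kernel-verified Lean document; each statement's English description precedes it below -/
import Mathlib

section
/- The positive edge labeling of the increasing flip graph of any subword complex SC(Q,ρ) on a finite Coxeter system is an EL-labeling: between any two facets I, J with a directed path from I to J, there is a unique rising path, and its label word is lexicographically first among all directed paths from I to J. -/
open scoped Classical

/-- Directed walks in a graph `E`, recorded by the list of vertices after the start. -/
inductive DWalk {α : Type*} (E : α → α → Prop) : α → α → List α → Prop
  | nil (u : α) : DWalk E u u []
  | cons {u w v : α} {l : List α} : E u w → DWalk E w v l → DWalk E u v (w :: l)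

/-- The sequence of edge labels along a walk from `u` with vertex list `l`. -/
def wLabels {α : Type*} (lab : α → α → ℕ) (u : α) (l : List α) : List ℕ :=
  List.zipWith lab (u :: l) l

/-- A facet of the subword complex `SC(Q, ρ)`: a set of positions whose complement is
a reduced expression for `ρ` as a subword of `Q`. -/
def IsSCFacet {B W : Type*} [Group W] {M : CoxeterMatrix B} (cs : CoxeterSystem M W)
    {m : ℕ} (Q : Fin m → B) (ρ : W) (I : Finset (Fin m)) : Prop :=
  cs.wordProd ((Iᶜ.sort (· ≤ ·)).map Q) = ρ ∧ Iᶜ.card = cs.length ρ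

/-- The edges of the increasing flip graph: `I → J` whenever `I∖{i} = J∖{j}` with
`i < j`. -/
def FlipEdge {B W : Type*} [Group W] {M : CoxeterMatrix B} (cs : CoxeterSystem M W)
    {m : ℕ} (Q : Fin m → B) (ρ : W) (I J : Finset (Fin m)) : Prop :=
  IsSCFacet cs Q ρ I ∧ IsSCFacet cs Q ρ J ∧
    ∃ i ∈ I, ∃ j ∈ J, i < j ∧ I.erase i = J.erase j

/-- The positive edge label of a flip `I → J`: the position flipped out,
i.e. the unique element of `I ∖ J`. -/
def pLab {m : ℕ} (I J : Finset (Fin m)) : ℕ := (I \ J).sup Fin.val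

/-- The negative edge label of a flip `I → J`: the position flipped in,
i.e. the unique element of `J ∖ I`. -/
def nLab {m : ℕ} (I J : Finset (Fin m)) : ℕ := (J \ I).sup Fin.val


section Cocycle

variable {B W : Type*} [Group W] {M : CoxeterMatrix B} (cs : CoxeterSystem M W)

/-- The elementary step of the parity action. -/
noncomputable def parStep (i : B) : Function.End (W × ZMod 2) :=
  fun p => (cs.simple i * p.1 * cs.simple i, p.2 + if p.1 = cs.simple i then 1 else 0)

theorem end_one_app {V : Type*} (p : V × ZMod 2) : (1 : Function.End (V × ZMod 2)) p = p := rfl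

theorem parStep_pow (i j : B) (n : ℕ) (x : W) (e : ZMod 2) :
    ((parStep cs i * parStep cs j) ^ n : Function.End (W × ZMod 2)) (x, e) =
      ((cs.simple i * cs.simple j) ^ n * x * ((cs.simple i * cs.simple j) ^ n)⁻¹,
        e + ∑ k ∈ Finset.range (2 * n),
          if x = ((cs.simple i * cs.simple j) ^ k)⁻¹ * cs.simple j then 1 else 0) := by
  have hj : cs.simple j * cs.simple j = 1 := cs.simple_mul_simple_self j
  have hi : cs.simple i * cs.simple i = 1 := cs.simple_mul_simple_self i
  have hji : (cs.simple j)⁻¹ = cs.simple j := cs.inv_simple j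
  have hii : (cs.simple i)⁻¹ = cs.simple i := cs.inv_simple i
  set r := cs.simple i * cs.simple j with hr
  have hrj : cs.simple j * r * (cs.simple j)⁻¹ = r⁻¹ := by
    rw [hr, mul_inv_rev, hji, hii]; simp [mul_assoc, hj]
  have hconj : ∀ k : ℕ, (r ^ k)⁻¹ * cs.simple j = cs.simple j * r ^ k := by
    intro k
    have : cs.simple j * r ^ k * (cs.simple j)⁻¹ = (r ^ k)⁻¹ := by
      rw [← conj_pow, hrj, inv_pow]
    rw [← this]; simp
  induction n with
  | zero => simp [end_one_app]
  | succ n ih =>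
    have hstep : ((parStep cs i * parStep cs j) ^ (n + 1) : Function.End (W × ZMod 2)) (x, e)
        = (parStep cs i) ((parStep cs j)
            (((parStep cs i * parStep cs j) ^ n : Function.End (W × ZMod 2)) (x, e))) := by
      rw [pow_succ']; rfl
    rw [hstep, ih]
    have h1 : (r ^ n * x * (r ^ n)⁻¹ = cs.simple j) ↔ x = (r ^ (2 * n))⁻¹ * cs.simple j := by
      rw [mul_inv_eq_iff_eq_mul, ← hconj, ← eq_inv_mul_iff_mul_eq, ← mul_assoc, ← mul_inv_rev,
        ← pow_add, two_mul]
    have h2 : (cs.simple j * (r ^ n * x * (r ^ n)⁻¹) * cs.simple j = cs.simple i) ↔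
        x = (r ^ (2 * n + 1))⁻¹ * cs.simple j := by
      have : (cs.simple j * (r ^ n * x * (r ^ n)⁻¹) * cs.simple j = cs.simple i) ↔
        r ^ n * x * (r ^ n)⁻¹ = r⁻¹ * cs.simple j := by
        constructor
        · intro h
          have h' : r⁻¹ * cs.simple j = cs.simple j * cs.simple i * cs.simple j := by
            rw [hr, mul_inv_rev, hji, hii]
          rw [h', ← h]
          simp only [mul_assoc, hj, mul_one]
          rw [← mul_assoc (cs.simple j), hj, one_mul]
        · intro h
          rw [h, hr, mul_inv_rev, hji, hii]
          simp [mul_assoc, hj]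
      rw [this, mul_inv_eq_iff_eq_mul, mul_assoc, ← hconj, ← eq_inv_mul_iff_mul_eq]
      have e : (r ^ (2 * n + 1))⁻¹ = (r ^ n)⁻¹ * (r⁻¹ * (r ^ n)⁻¹) := by
        rw [← mul_inv_rev, ← mul_inv_rev, ← pow_succ, ← pow_add]
        congr 2; omega
      rw [e]; simp only [mul_assoc]
    simp only [parStep, h1, h2]
    rw [show 2 * (n + 1) = 2 * n + 1 + 1 by ring, Finset.sum_range_succ, Finset.sum_range_succ]
    refine Prod.ext ?_ ?_
    · simp only
      have hri : r⁻¹ = cs.simple j * cs.simple i := by rw [hr, mul_inv_rev, hji, hii]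
      rw [pow_succ' r n, mul_inv_rev, hri]
      generalize r ^ n = y
      rw [hr]
      simp only [mul_assoc]
    · simp only [add_assoc]

theorem parStep_liftable : M.IsLiftable (parStep cs) := by
  intro i j
  funext p
  obtain ⟨x, e⟩ := p
  rw [parStep_pow, cs.simple_mul_simple_pow, two_mul, Finset.sum_range_add]
  have : ∀ k, (cs.simple i * cs.simple j) ^ (M i j + k) = (cs.simple i * cs.simple j) ^ k := by
    intro k; rw [pow_add, cs.simple_mul_simple_pow, one_mul]
  simp only [this, CharTwo.add_self_eq_zero]
  simp [end_one_app]

/-- The parity action. -/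
noncomputable def parAct : W →* Function.End (W × ZMod 2) :=
  cs.lift ⟨parStep cs, parStep_liftable cs⟩

/-- The inversion parity of `t` with respect to `w`. -/
noncomputable def invPar (w t : W) : ZMod 2 := (parAct cs w (w⁻¹ * t * w, 0)).2

theorem parAct_add (w : W) : ∀ (x : W) (e : ZMod 2),
    (parAct cs w (x, e)).2 = (parAct cs w (x, 0)).2 + e := by
  induction w using cs.simple_induction_left with
  | one => intro x e; simp [end_one_app]
  | mul_simple_left w i ih =>
    have hfst : ∀ w : W, ∀ (x : W) (e e' : ZMod 2),
        (parAct cs w (x, e)).1 = (parAct cs w (x, e')).1 := by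
      intro w
      induction w using cs.simple_induction_left with
      | one => intro x e e'; simp [end_one_app]
      | mul_simple_left w i ih =>
        intro x e e'
        rw [map_mul]
        show (parAct cs (cs.simple i) (parAct cs w (x, e))).1 =
          (parAct cs (cs.simple i) (parAct cs w (x, e'))).1
        rw [parAct, cs.lift_apply_simple]
        simp only [parStep]
        have := ih x e e'
        rw [parAct] at this
        rw [this]
    intro x e
    rw [map_mul]
    show (parAct cs (cs.simple i) (parAct cs w (x, e))).2 =
          (parAct cs (cs.simple i) (parAct cs w (x, 0))).2 + e
    have h1 := hfst w x e 0
    have h2 := ih x e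
    have h3 : parAct cs (cs.simple i) = parStep cs i := by rw [parAct, cs.lift_apply_simple]
    rw [h3]
    simp only [parStep]
    rw [h1, h2]
    ring

theorem invPar_one (t : W) : invPar cs 1 t = 0 := by
  simp [invPar, end_one_app]

theorem invPar_mul_simple (w t : W) (i : B) :
    invPar cs (w * cs.simple i) t =
      invPar cs w t + if t = w * cs.simple i * w⁻¹ then 1 else 0 := by
  have h3 : parAct cs (cs.simple i) = parStep cs i := by rw [parAct, cs.lift_apply_simple]
  unfold invPar
  rw [map_mul]
  show (parAct cs w (parAct cs (cs.simple i) _)).2 = _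
  rw [h3]
  simp only [parStep]
  rw [parAct_add]
  have e1 : cs.simple i * ((w * cs.simple i)⁻¹ * t * (w * cs.simple i)) * cs.simple i
      = w⁻¹ * t * w := by
    rw [mul_inv_rev, cs.inv_simple]
    simp [mul_assoc]
  have e2 : ((w * cs.simple i)⁻¹ * t * (w * cs.simple i) = cs.simple i) ↔
      t = w * cs.simple i * w⁻¹ := by
    rw [mul_assoc, inv_mul_eq_iff_eq_mul, ← mul_assoc, mul_left_inj, ← eq_mul_inv_iff_mul_eq]
  simp only [e1, e2, zero_add]

end Cocycle

section Facets

variable {B W : Type*} [Group W] {M : CoxeterMatrix B} (cs : CoxeterSystem M W)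
  {m : ℕ} (Q : Fin m → B)

/-- Product of the letters at positions `< n` outside `I`. -/
noncomputable def prefP (I : Finset (Fin m)) : ℕ → W
  | 0 => 1
  | n + 1 => prefP I n *
      (if h : n < m then (if (⟨n, h⟩ : Fin m) ∈ I then 1 else cs.simple (Q ⟨n, h⟩)) else 1)

/-- The reflection attached to position `k` by the set `I`. -/
noncomputable def posRefl (I : Finset (Fin m)) (k : Fin m) : W :=
  prefP cs Q I k * cs.simple (Q k) * (prefP cs Q I k)⁻¹

theorem prefP_succ_mem {I : Finset (Fin m)} {k : Fin m} (h : k ∈ I) :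
    prefP cs Q I (k + 1) = prefP cs Q I k := by
  simp [prefP, h]

theorem prefP_succ_notMem {I : Finset (Fin m)} {k : Fin m} (h : k ∉ I) :
    prefP cs Q I (k + 1) = prefP cs Q I k * cs.simple (Q k) := by
  simp [prefP, h]

theorem prefP_congr {I J : Finset (Fin m)} (n : ℕ)
    (h : ∀ d : Fin m, (d : ℕ) < n → (d ∈ I ↔ d ∈ J)) : prefP cs Q I n = prefP cs Q J n := by
  induction n with
  | zero => rfl
  | succ n ih =>
    rw [prefP, prefP, ih (fun d hd => h d (by omega))]
    by_cases hn : n < m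
    · simp only [hn, dif_pos, h ⟨n, hn⟩ (by simp)]
    · simp only [hn, dif_neg, not_false_eq_true]

theorem posRefl_congr {I J : Finset (Fin m)} (k : Fin m)
    (h : ∀ d : Fin m, d < k → (d ∈ I ↔ d ∈ J)) : posRefl cs Q I k = posRefl cs Q J k := by
  rw [posRefl, posRefl, prefP_congr cs Q k (fun d hd => h d hd)]

theorem prefP_insert_le {I : Finset (Fin m)} {k : Fin m} {n : ℕ} (h : n ≤ k) :
    prefP cs Q (insert k I) n = prefP cs Q I n := by
  apply prefP_congr
  intro d hd
  have : d ≠ k := by rintro rfl; omega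
  simp [this]

theorem posRefl_mul_self (I : Finset (Fin m)) (k : Fin m) : posRefl cs Q I k * posRefl cs Q I k = 1 := by
  simp [posRefl, mul_assoc]

theorem posRefl_inv (I : Finset (Fin m)) (k : Fin m) : (posRefl cs Q I k)⁻¹ = posRefl cs Q I k :=
  inv_eq_of_mul_eq_one_left (posRefl_mul_self cs Q I k)

theorem prefP_insert_lt {I : Finset (Fin m)} {k : Fin m} (hk : k ∉ I) {n : ℕ} (h : (k : ℕ) < n) :
    prefP cs Q (insert k I) n = posRefl cs Q I k * prefP cs Q I n := by
  induction n, h using Nat.le_induction with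
  | base =>
    rw [prefP_succ_mem cs Q (Finset.mem_insert_self k I), prefP_succ_notMem cs Q hk,
      prefP_insert_le cs Q le_rfl, posRefl]
    simp [mul_assoc]
  | succ n hn ih =>
    rw [prefP, prefP, ih, mul_assoc]
    by_cases hnm : n < m
    · have : (⟨n, hnm⟩ : Fin m) ≠ k := by
        intro e; rw [← e] at hn; simp at hn
      simp [hnm, this]
    · simp [hnm]

theorem posRefl_insert_le {I : Finset (Fin m)} {k l : Fin m} (h : l ≤ k) :
    posRefl cs Q (insert k I) l = posRefl cs Q I l := by
  rw [posRefl, posRefl, prefP_insert_le cs Q h]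

theorem posRefl_insert_lt {I : Finset (Fin m)} {k l : Fin m} (hk : k ∉ I) (h : k < l) :
    posRefl cs Q (insert k I) l = posRefl cs Q I k * posRefl cs Q I l * posRefl cs Q I k := by
  rw [posRefl, posRefl.eq_1 cs Q I l, prefP_insert_lt cs Q hk h, mul_inv_rev, posRefl_inv]
  simp only [mul_assoc]

theorem wordProd_sort_eq (I : Finset (Fin m)) (n : ℕ) :
    cs.wordProd (((Iᶜ.filter (fun d : Fin m => (d : ℕ) < n)).sort (· ≤ ·)).map Q)
      = prefP cs Q I n := by
  induction n with
  | zero => simp [prefP]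
  | succ n ih =>
    rw [prefP, ← ih]
    by_cases hn : n < m
    · by_cases hI : (⟨n, hn⟩ : Fin m) ∈ I
      · have : Iᶜ.filter (fun d : Fin m => (d : ℕ) < n + 1)
            = Iᶜ.filter (fun d : Fin m => (d : ℕ) < n) := by
          ext d
          simp only [Finset.mem_filter, Finset.mem_compl]
          refine and_congr_right fun hd => ?_
          have : (d : ℕ) ≠ n := by rintro rfl; exact hd hI
          omega
        rw [this]; simp [hn, hI]
      · have : (Iᶜ.filter (fun d : Fin m => (d : ℕ) < n + 1)).sort (· ≤ ·)
            = (Iᶜ.filter (fun d : Fin m => (d : ℕ) < n)).sort (· ≤ ·) ++ [⟨n, hn⟩] := by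
          refine List.Perm.eq_of_pairwise' (r := (· ≤ ·)) (Finset.pairwise_sort _ _) ?_ ?_
          · rw [List.pairwise_append]
            refine ⟨Finset.pairwise_sort _ _, by simp, ?_⟩
            intro a ha b hb
            simp at ha hb
            subst hb
            exact Fin.le_def.2 (by simp; omega)
          · rw [List.perm_ext_iff_of_nodup (Finset.sort_nodup _ _)]
            · intro d
              simp only [Finset.mem_sort, Finset.mem_filter, Finset.mem_compl, List.mem_append,
                List.mem_singleton, Fin.ext_iff]
              constructor
              · rintro ⟨h1, h2⟩
                by_cases h : (d : ℕ) = n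
                · exact Or.inr h
                · exact Or.inl ⟨h1, by omega⟩
              · rintro (⟨h1, h2⟩ | h)
                · exact ⟨h1, by omega⟩
                · refine ⟨?_, by omega⟩
                  have : d = ⟨n, hn⟩ := Fin.ext h
                  rwa [this]
            · rw [List.nodup_append]
              refine ⟨Finset.sort_nodup _ _, by simp, ?_⟩
              intro a ha b hb
              simp at ha hb
              subst hb
              intro e
              rw [e] at ha
              simp at ha
        rw [this, List.map_append, cs.wordProd_append]
        simp [hn, hI]
    · have : Iᶜ.filter (fun d : Fin m => (d : ℕ) < n + 1)
            = Iᶜ.filter (fun d : Fin m => (d : ℕ) < n) := by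
        ext d
        have := d.2
        simp only [Finset.mem_filter, Finset.mem_compl]
        refine and_congr_right fun hd => ?_
        omega
      rw [this]; simp [hn]

theorem wordProd_sort_eq' (I : Finset (Fin m)) :
    cs.wordProd ((Iᶜ.sort (· ≤ ·)).map Q) = prefP cs Q I m := by
  rw [← wordProd_sort_eq]
  congr 3
  ext d
  simp

theorem facet_iff (ρ : W) (I : Finset (Fin m)) :
    IsSCFacet cs Q ρ I ↔ prefP cs Q I m = ρ ∧ Iᶜ.card = cs.length ρ := by
  rw [IsSCFacet, wordProd_sort_eq']

theorem length_prefP_le (I : Finset (Fin m)) : cs.length (prefP cs Q I m) ≤ Iᶜ.card := by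
  rw [← wordProd_sort_eq']
  refine (cs.length_wordProd_le _).trans ?_
  simp

theorem invPar_prefP (I : Finset (Fin m)) (t : W) (n : ℕ) :
    invPar cs (prefP cs Q I n) t =
      (((Iᶜ.filter (fun d : Fin m => (d : ℕ) < n ∧ t = posRefl cs Q I d)).card : ℕ) : ZMod 2) := by
  induction n with
  | zero => simp [prefP, invPar_one]
  | succ n ih =>
    by_cases hn : n < m
    · by_cases hI : (⟨n, hn⟩ : Fin m) ∈ I
      · rw [prefP_succ_mem cs Q hI, ih]
        congr 2
        ext d
        simp only [Finset.mem_filter, Finset.mem_compl]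
        refine and_congr_right fun hd => and_congr_left fun _ => ?_
        have : (d : ℕ) ≠ n := by rintro rfl; exact hd hI
        omega
      · rw [prefP_succ_notMem cs Q hI, invPar_mul_simple, ih]
        have key : (t = prefP cs Q I n * cs.simple (Q ⟨n, hn⟩) * (prefP cs Q I n)⁻¹) ↔
          t = posRefl cs Q I ⟨n, hn⟩ := Iff.rfl
        simp only [key]
        by_cases ht : t = posRefl cs Q I ⟨n, hn⟩
        · have : Iᶜ.filter (fun d : Fin m => (d : ℕ) < n + 1 ∧ t = posRefl cs Q I d) =
            insert ⟨n, hn⟩ (Iᶜ.filter (fun d : Fin m => (d : ℕ) < n ∧ t = posRefl cs Q I d)) := by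
            ext d
            simp only [Finset.mem_filter, Finset.mem_compl, Finset.mem_insert]
            constructor
            · rintro ⟨h1, h2, h3⟩
              by_cases h : d = ⟨n, hn⟩
              · exact Or.inl h
              · have : (d : ℕ) ≠ n := fun e => h (Fin.ext e)
                exact Or.inr ⟨h1, by omega, h3⟩
            · rintro (h | ⟨h1, h2, h3⟩)
              · subst h; exact ⟨hI, by simp, ht⟩
              · exact ⟨h1, by omega, h3⟩
          rw [this, Finset.card_insert_of_notMem (by simp)]
          simp only [← ht, if_true]
          push_cast
          rfl
        · simp only [ht, if_false, add_zero]
          congr 2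
          ext d
          simp only [Finset.mem_filter, Finset.mem_compl]
          refine and_congr_right fun hd => and_congr_left fun h3 => ?_
          have : (d : ℕ) ≠ n := by rintro rfl; exact ht h3
          omega
    · have : prefP cs Q I (n + 1) = prefP cs Q I n := by simp [prefP, hn]
      rw [this, ih]
      congr 2
      ext d
      have := d.2
      simp only [Finset.mem_filter, Finset.mem_compl]
      refine and_congr_right fun hd => and_congr_left fun _ => ?_
      omega

variable {cs Q} {ρ : W}

theorem posRefl_ne_of_lt {I : Finset (Fin m)} (hI : IsSCFacet cs Q ρ I) {k l : Fin m}
    (hk : k ∉ I) (hl : l ∉ I) (hkl : k < l) : posRefl cs Q I k ≠ posRefl cs Q I l := by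
  intro e
  rw [facet_iff] at hI
  have hl' : l ∉ insert k I := by simp [hl, hkl.ne']
  have h1 : prefP cs Q (insert l (insert k I)) m = prefP cs Q I m := by
    rw [prefP_insert_lt cs Q hl' l.2, prefP_insert_lt cs Q hk k.2, posRefl_insert_lt cs Q hk hkl, ← e,
      posRefl_mul_self, one_mul, ← mul_assoc, posRefl_mul_self, one_mul]
  have h2 := length_prefP_le cs Q (insert l (insert k I))
  rw [h1, hI.1, ← hI.2, Finset.card_compl, Finset.card_compl, Finset.card_insert_of_notMem hl',
    Finset.card_insert_of_notMem hk] at h2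
  have h3 : (insert l (insert k I)).card ≤ Fintype.card (Fin m) := Finset.card_le_univ _
  rw [Finset.card_insert_of_notMem hl', Finset.card_insert_of_notMem hk] at h3
  omega

theorem posRefl_inj {I : Finset (Fin m)} (hI : IsSCFacet cs Q ρ I) {k l : Fin m}
    (hk : k ∉ I) (hl : l ∉ I) (h : posRefl cs Q I k = posRefl cs Q I l) : k = l := by
  rcases lt_trichotomy k l with h1 | h1 | h1
  · exact absurd h (posRefl_ne_of_lt hI hk hl h1)
  · exact h1
  · exact absurd h.symm (posRefl_ne_of_lt hI hl hk h1)

theorem exists_partner {I J : Finset (Fin m)} (hI : IsSCFacet cs Q ρ I)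
    (hJ : IsSCFacet cs Q ρ J) {k : Fin m} (hk : k ∉ J) :
    ∃ l, l ∉ I ∧ posRefl cs Q I l = posRefl cs Q J k := by
  have e1 := invPar_prefP cs Q I (posRefl cs Q J k) m
  have e2 := invPar_prefP cs Q J (posRefl cs Q J k) m
  rw [((facet_iff cs Q ρ I).1 hI).1] at e1
  rw [((facet_iff cs Q ρ J).1 hJ).1, e1] at e2
  have h1 : Jᶜ.filter (fun d : Fin m => (d : ℕ) < m ∧ posRefl cs Q J k = posRefl cs Q J d) = {k} := by
    ext d
    simp only [Finset.mem_filter, Finset.mem_compl, Finset.mem_singleton]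
    constructor
    · rintro ⟨h1, _, h3⟩
      exact (posRefl_inj hJ hk h1 h3).symm
    · rintro rfl
      exact ⟨hk, d.2, rfl⟩
  rw [h1] at e2
  by_contra hne
  push Not at hne
  have h2 : Iᶜ.filter (fun d : Fin m => (d : ℕ) < m ∧ posRefl cs Q J k = posRefl cs Q I d) = ∅ := by
    ext d
    simp only [Finset.mem_filter, Finset.mem_compl, Finset.notMem_empty, iff_false]
    rintro ⟨h1, _, h3⟩
    exact hne d h1 h3.symm
  rw [h2] at e2
  simp at e2

end Facets

section Flips

variable {B W : Type*} [Group W] {M : CoxeterMatrix B} {cs : CoxeterSystem M W}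
  {m : ℕ} {Q : Fin m → B} {ρ : W}

theorem flip_base {I : Finset (Fin m)} {i l : Fin m} (hi : i ∈ I) (hl : l ∉ I) (hil : i < l) :
    posRefl cs Q I i = posRefl cs Q I l ↔
      posRefl cs Q (I.erase i) i = posRefl cs Q (I.erase i) l := by
  have hI : insert i (I.erase i) = I := Finset.insert_erase hi
  have h1 : posRefl cs Q I i = posRefl cs Q (I.erase i) i := by
    conv_lhs => rw [← hI]
    exact posRefl_insert_le cs Q le_rfl
  have h2 : posRefl cs Q I l = posRefl cs Q (I.erase i) i * posRefl cs Q (I.erase i) l *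
      posRefl cs Q (I.erase i) i := by
    conv_lhs => rw [← hI]
    exact posRefl_insert_lt cs Q (Finset.notMem_erase i I) hil
  rw [h1, h2]
  constructor
  · intro h
    have h3 := mul_eq_right.1 h.symm
    rw [mul_eq_one_iff_eq_inv, posRefl_inv] at h3
    exact h3
  · intro h
    rw [← h, posRefl_mul_self, one_mul]

theorem edge_iff {I J : Finset (Fin m)} :
    FlipEdge cs Q ρ I J ↔ IsSCFacet cs Q ρ I ∧ ∃ i l : Fin m, i < l ∧ i ∈ I ∧ l ∉ I ∧
      posRefl cs Q I i = posRefl cs Q I l ∧ J = insert l (I.erase i) := by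
  constructor
  · rintro ⟨hI, hJ, i, hi, l, hl, hil, he⟩
    have hJe : J = insert l (I.erase i) := by rw [he, Finset.insert_erase hl]
    have hlI : l ∉ I := by
      intro h
      have : l ∈ I.erase i := Finset.mem_erase.2 ⟨hil.ne', h⟩
      rw [he] at this
      simp at this
    refine ⟨hI, i, l, hil, hi, hlI, ?_, hJe⟩
    rw [flip_base hi hlI hil]
    have e1 := ((facet_iff cs Q ρ I).1 hI).1
    have e2 := ((facet_iff cs Q ρ J).1 hJ).1
    rw [hJe, prefP_insert_lt cs Q (by simp [hlI]) l.2] at e2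
    rw [← Finset.insert_erase hi, prefP_insert_lt cs Q (by simp) i.2] at e1
    exact mul_right_cancel (e1.trans e2.symm)
  · rintro ⟨hI, i, l, hil, hi, hlI, ht, hJ⟩
    rw [flip_base hi hlI hil] at ht
    have hlK : l ∉ I.erase i := by simp [hlI]
    refine ⟨hI, ?_, i, hi, l, by simp [hJ], hil, ?_⟩
    · rw [facet_iff] at hI ⊢
      constructor
      · rw [← hI.1, hJ, prefP_insert_lt cs Q hlK l.2, ← ht,
          ← prefP_insert_lt cs Q (Finset.notMem_erase i I) i.2, Finset.insert_erase hi]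
      · rw [← hI.2, Finset.card_compl, Finset.card_compl, hJ, Finset.card_insert_of_notMem hlK,
          Finset.card_erase_add_one hi]
    · rw [hJ, Finset.erase_insert hlK]

theorem flip_out {I J : Finset (Fin m)} {i l k : Fin m} (hil : i < l) (hi : i ∈ I) (hl : l ∉ I)
    (ht : posRefl cs Q I i = posRefl cs Q I l) (hJ : J = insert l (I.erase i))
    (hk : k ≤ i ∨ l < k) : posRefl cs Q J k = posRefl cs Q I k := by
  rcases hk with hk | hk
  · apply posRefl_congr
    intro d hd
    have h1 : d ≠ i := (hd.trans_le hk).ne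
    have h2 : d ≠ l := ((hd.trans_le hk).trans hil).ne
    simp [hJ, h1, h2]
  · rw [flip_base hi hl hil] at ht
    have hlK : l ∉ I.erase i := by simp [hl]
    conv_rhs => rw [← Finset.insert_erase hi]
    rw [hJ, posRefl_insert_lt cs Q hlK hk, posRefl_insert_lt cs Q (Finset.notMem_erase i I)
      (hil.trans hk), ht]

theorem flip_in {I J : Finset (Fin m)} {i l k : Fin m} (hi : i ∈ I)
    (hJ : J = insert l (I.erase i))
    (hk : i < k) (hk' : k ≤ l) :
    posRefl cs Q J k = posRefl cs Q I i * posRefl cs Q I k * posRefl cs Q I i := by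
  have hI : insert i (I.erase i) = I := Finset.insert_erase hi
  have h1 : posRefl cs Q I i = posRefl cs Q (I.erase i) i := by
    conv_lhs => rw [← hI]
    exact posRefl_insert_le cs Q le_rfl
  have h2 : posRefl cs Q I k = posRefl cs Q (I.erase i) i * posRefl cs Q (I.erase i) k *
      posRefl cs Q (I.erase i) i := by
    conv_lhs => rw [← hI]
    exact posRefl_insert_lt cs Q (Finset.notMem_erase i I) hk
  rw [h1, h2, hJ, posRefl_insert_le cs Q hk']
  simp only [mul_assoc, posRefl_mul_self, mul_one]
  rw [← mul_assoc, posRefl_mul_self, one_mul]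

/-- No element of `S ∖ F` has an increasing flip. -/
def IsSink (cs : CoxeterSystem M W) (Q : Fin m → B) (ρ : W) (F S : Finset (Fin m)) : Prop :=
  IsSCFacet cs Q ρ S ∧ F ⊆ S ∧
    ∀ k ∈ S, k ∉ F → ∀ l, l ∉ S → k < l → posRefl cs Q S k ≠ posRefl cs Q S l

theorem sink_unique_aux {F S S' : Finset (Fin m)} (hS : IsSink cs Q ρ F S)
    (hS' : IsSink cs Q ρ F S') {k : Fin m} (hd : ∀ d < k, (d ∈ S ↔ d ∈ S')) (hk : k ∉ S) :
    k ∉ S' := by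
  intro hk'
  have ht : posRefl cs Q S k = posRefl cs Q S' k := posRefl_congr cs Q k hd
  obtain ⟨l, hl, hlt⟩ := exists_partner hS'.1 hS.1 hk
  rcases lt_trichotomy l k with h | h | h
  · have h1 : l ∉ S := fun h2 => hl ((hd l h).1 h2)
    have h2 : posRefl cs Q S l = posRefl cs Q S' l :=
      posRefl_congr cs Q l fun d hdl => hd d (hdl.trans h)
    exact h.ne (posRefl_inj hS.1 h1 hk (h2.trans hlt))
  · subst h; exact hl hk'
  · exact hS'.2.2 k hk' (fun hF => hk (hS.2.1 hF)) l hl h (by rw [hlt, ht])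

theorem sink_unique {F S S' : Finset (Fin m)} (hS : IsSink cs Q ρ F S)
    (hS' : IsSink cs Q ρ F S') : S = S' := by
  ext k
  induction k using WellFoundedLT.induction with
  | ind k ih =>
    have h1 := sink_unique_aux hS hS' ih
    have h2 := sink_unique_aux hS' hS (fun d hd => (ih d hd).symm)
    exact ⟨fun hS0 => by_contra fun hn => h2 hn hS0, fun hS0 => by_contra fun hn => h1 hn hS0⟩

/-- Sum of positions. -/
def posSum (I : Finset (Fin m)) : ℕ := ∑ d ∈ I, (d : ℕ)

theorem posSum_lt {I J : Finset (Fin m)} (h : FlipEdge cs Q ρ I J) : posSum I < posSum J := by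
  obtain ⟨_, i, l, hil, hi, hl, _, hJ⟩ := edge_iff.1 h
  rw [hJ, posSum, posSum, Finset.sum_insert (by simp [hl]), ← Finset.add_sum_erase _ _ hi]
  have : (i : ℕ) < l := hil
  omega

theorem posSum_le (I : Finset (Fin m)) : posSum I ≤ posSum (Finset.univ : Finset (Fin m)) :=
  Finset.sum_le_sum_of_subset (Finset.subset_univ I)

theorem reach_sink (F : Finset (Fin m)) (n : ℕ) : ∀ X : Finset (Fin m),
    posSum (Finset.univ : Finset (Fin m)) - posSum X = n → IsSCFacet cs Q ρ X → F ⊆ X →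
    ∃ S, IsSink cs Q ρ F S ∧ Relation.ReflTransGen (FlipEdge cs Q ρ) X S := by
  induction n using Nat.strong_induction_on with
  | _ n ih =>
    intro X hn hX hF
    by_cases h : IsSink cs Q ρ F X
    · exact ⟨X, h, .refl⟩
    · have : ∃ k ∈ X, k ∉ F ∧ ∃ l, l ∉ X ∧ k < l ∧ posRefl cs Q X k = posRefl cs Q X l := by
        by_contra hc
        push Not at hc
        exact h ⟨hX, hF, fun k hk hkF l hl hkl => hc k hk hkF l hl hkl⟩
      obtain ⟨k, hk, hkF, l, hl, hkl, ht⟩ := this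
      have hE : FlipEdge cs Q ρ X (insert l (X.erase k)) :=
        edge_iff.2 ⟨hX, k, l, hkl, hk, hl, ht, rfl⟩
      have h1 := posSum_lt hE
      have h2 := posSum_le (insert l (X.erase k))
      obtain ⟨S, hS, hR⟩ := ih _ (by omega) (insert l (X.erase k)) rfl hE.2.1 (by
        intro x hx
        have : x ≠ k := by rintro rfl; exact hkF hx
        simp [this, hF hx])
      exact ⟨S, hS, .head hE hR⟩

theorem swap_lemma {I I1 I2 : Finset (Fin m)} {i a : Fin m}
    (h1 : FlipEdge cs Q ρ I I1) (h2 : FlipEdge cs Q ρ I1 I2)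
    (ha : a ∈ I) (ha1 : a ∉ I1) (hi : i ∈ I1) (hi2 : i ∉ I2) (hia : i < a) :
    ∃ I', FlipEdge cs Q ρ I I' ∧ i ∈ I ∧ i ∉ I' ∧
      Relation.ReflTransGen (FlipEdge cs Q ρ) I' I2 := by
  have hI2f := h2.2.1
  have hI1f := h1.2.1
  have hIf := h1.1
  obtain ⟨_, a', b, hab, ha', hb, htab, hI1⟩ := edge_iff.1 h1
  obtain ⟨_, i', j, hij, hi', hj, htij, hI2⟩ := edge_iff.1 h2
  have : a = a' := by
    by_contra h; apply ha1; rw [hI1]; simp [h, ha]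
  subst this
  have : i = i' := by
    by_contra h; apply hi2; rw [hI2]; simp [h, hi]
  subst this
  have hiI : i ∈ I := by
    rw [hI1] at hi
    simp only [Finset.mem_insert, Finset.mem_erase] at hi
    rcases hi with rfl | h
    · exact absurd (hia.trans hab) (lt_irrefl _)
    · exact h.2
  have hbI1 : b ∈ I1 := by simp [hI1]
  have hjb : j ≠ b := by rintro rfl; exact hj hbI1
  have hti : posRefl cs Q I1 i = posRefl cs Q I i := flip_out hab ha hb htab hI1 (Or.inl hia.le)
  -- the partner of `i` in `I`
  obtain ⟨j', hj', htj'⟩ := exists_partner hIf hI1f hj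
  rw [← htij, hti] at htj'
  have hij' : i < j' := by
    by_contra h
    have hne : j' ≠ i := by rintro rfl; exact hj' hiI
    have hlt : j' < i := lt_of_le_of_ne (not_lt.1 h) hne
    have e : posRefl cs Q I1 j' = posRefl cs Q I j' :=
      flip_out hab ha hb htab hI1 (Or.inl (hlt.trans hia).le)
    have hn : j' ∉ I1 := by
      rw [hI1]
      simp [hj', ((hlt.trans hia).trans hab).ne]
    have := posRefl_inj hI1f hn hj (by rw [e, htj', ← hti, htij])
    subst this
    exact absurd (hij.trans hlt) (lt_irrefl _)
  have hE : FlipEdge cs Q ρ I (insert j' (I.erase i)) :=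
    edge_iff.2 ⟨hIf, i, j', hij', hiI, hj', htj'.symm, rfl⟩
  refine ⟨_, hE, hiI, by simp [hij'.ne], ?_⟩
  obtain ⟨S, hS, hR⟩ := reach_sink (cs := cs) (Q := Q) (ρ := ρ) ((I.erase a).erase i) _
    (insert j' (I.erase i)) rfl hE.2.1 (by
      intro x hx
      simp only [Finset.mem_erase] at hx
      simp [hx.1, hx.2.2])
  have hS2 : IsSink cs Q ρ ((I.erase a).erase i) I2 := by
    refine ⟨hI2f, ?_, ?_⟩
    · intro x hx
      simp only [Finset.mem_erase] at hx
      simp [hI2, hI1, hx.1, hx.2.1, hx.2.2]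
    · intro k hk hkF l hl hkl ht
      have hkjb : k = j ∨ k = b := by
        rw [hI2, hI1] at hk
        simp only [Finset.mem_insert, Finset.mem_erase] at hk
        simp only [Finset.mem_erase] at hkF
        tauto
      rcases hkjb with rfl | rfl
      · -- the partner of `j` in `I2` is `i`
        have e1 : posRefl cs Q I2 i = posRefl cs Q I1 i :=
          flip_out hij hi hj htij hI2 (Or.inl le_rfl)
        have e2 : posRefl cs Q I2 k = posRefl cs Q I1 i := by
          rw [flip_in hi hI2 hij le_rfl, ← htij, posRefl_mul_self, one_mul]
        have := posRefl_inj hI2f hi2 hl (by rw [e1, ← e2, ht])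
        subst this
        exact absurd (hij.trans hkl) (lt_irrefl _)
      · have e1 : posRefl cs Q I1 a = posRefl cs Q I a :=
          flip_out hab ha hb htab hI1 (Or.inl le_rfl)
        have e2 : posRefl cs Q I1 k = posRefl cs Q I a := by
          rw [flip_in ha hI1 hab le_rfl, ← htab, posRefl_mul_self, one_mul]
        rcases lt_or_gt_of_ne hjb with h | h
        · -- `j < b`
          have e3 : posRefl cs Q I2 k = posRefl cs Q I1 k :=
            flip_out hij hi hj htij hI2 (Or.inr h)
          have e4 : posRefl cs Q I2 l = posRefl cs Q I1 l :=
            flip_out hij hi hj htij hI2 (Or.inr (h.trans hkl))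
          have hl1 : l ∉ I1 := by
            intro hl1
            apply hl
            rw [hI2]
            have : l ≠ i := ((hia.trans hab).trans hkl).ne'
            simp [hl1, this]
          have := posRefl_inj hI1f ha1 hl1 (by rw [← e4, ← ht, e3, e2, e1])
          subst this
          exact absurd (hab.trans hkl) (lt_irrefl _)
        · -- `b < j`
          have e3 := flip_in (cs := cs) (Q := Q) hi hI2 (hia.trans hab) h.le
          have e4 := flip_in (cs := cs) (Q := Q) hi hI2 hia (hab.trans h).le
          have ha2 : a ∉ I2 := by
            rw [hI2]
            simp [ha1, (hab.trans h).ne]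
          have := posRefl_inj hI2f ha2 hl (by rw [← ht, e3, e4, e1, e2])
          subst this
          exact absurd (hab.trans hkl) (lt_irrefl _)
  rwa [sink_unique hS2 hS]

end Flips

section Walks

variable {B W : Type*} [Group W] {M : CoxeterMatrix B} {cs : CoxeterSystem M W}
  {m : ℕ} {Q : Fin m → B} {ρ : W}

/-- Extract the flipped position of an edge together with its label. -/
theorem edge_label {I J : Finset (Fin m)} (h : FlipEdge cs Q ρ I J) :
    ∃ a : Fin m, a ∈ I ∧ a ∉ J ∧ (∀ d < a, (d ∈ I ↔ d ∈ J)) ∧ pLab I J = a ∧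
      ∀ c ∈ I, c ∉ J → c = a := by
  obtain ⟨_, a, b, hab, ha, hb, _, hJ⟩ := edge_iff.1 h
  have huniq : ∀ c ∈ I, c ∉ J → c = a := by
    intro c hc hcJ
    by_contra hne
    exact hcJ (by simp [hJ, hne, hc])
  have haJ : a ∉ J := by simp [hJ, hab.ne]
  refine ⟨a, ha, haJ, ?_, ?_, huniq⟩
  · intro d hd
    simp [hJ, hd.ne, (hd.trans hab).ne]
  · have : I \ J = {a} := by
      ext c
      simp only [Finset.mem_sdiff, Finset.mem_singleton]
      exact ⟨fun hc => huniq c hc.1 hc.2, fun hc => hc ▸ ⟨ha, haJ⟩⟩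
    simp [pLab, this]

theorem edge_det {I J J' : Finset (Fin m)} {a : Fin m} (h : FlipEdge cs Q ρ I J)
    (h' : FlipEdge cs Q ρ I J') (ha : a ∈ I) (haJ : a ∉ J) (haJ' : a ∉ J') : J = J' := by
  obtain ⟨hI, i, l, hil, hi, hl, ht, hJ⟩ := edge_iff.1 h
  obtain ⟨_, i', l', hil', hi', hl', ht', hJ'⟩ := edge_iff.1 h'
  have e1 : a = i := by
    by_contra hne; exact haJ (by simp [hJ, hne, ha])
  have e2 : a = i' := by
    by_contra hne; exact haJ' (by simp [hJ', hne, ha])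
  subst e1
  subst e2
  have := posRefl_inj hI hl hl' (ht.symm.trans ht')
  rw [hJ, hJ', this]

theorem exists_walk_of_reach {I J : Finset (Fin m)}
    (h : Relation.ReflTransGen (FlipEdge cs Q ρ) I J) : ∃ l, DWalk (FlipEdge cs Q ρ) I J l := by
  induction h using Relation.ReflTransGen.head_induction_on with
  | refl => exact ⟨[], .nil _⟩
  | head h _ ih =>
    obtain ⟨l, hl⟩ := ih
    exact ⟨_, .cons h hl⟩

theorem reach_of_walk {I J : Finset (Fin m)} {l : List (Finset (Fin m))}
    (h : DWalk (FlipEdge cs Q ρ) I J l) : Relation.ReflTransGen (FlipEdge cs Q ρ) I J := by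
  induction h with
  | nil => exact .refl
  | cons h _ ih => exact .head h ih

theorem posSum_le_of_walk {I J : Finset (Fin m)} {l : List (Finset (Fin m))}
    (h : DWalk (FlipEdge cs Q ρ) I J l) : posSum I ≤ posSum J := by
  induction h with
  | nil => exact le_rfl
  | cons h _ ih => exact (posSum_lt h).le.trans ih

theorem first_step {I J : Finset (Fin m)} {l : List (Finset (Fin m))}
    (h : DWalk (FlipEdge cs Q ρ) I J l) (hne : I ≠ J) :
    ∃ i : Fin m, i ∈ I ∧ i ∉ J ∧ (∀ d < i, (d ∈ I ↔ d ∈ J)) ∧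
      ∃ I', FlipEdge cs Q ρ I I' ∧ i ∉ I' ∧ Relation.ReflTransGen (FlipEdge cs Q ρ) I' J := by
  induction h with
  | nil => exact absurd rfl hne
  | @cons I I1 J l hE hW ih =>
    obtain ⟨a, haI, ha1, hagree, _, _⟩ := edge_label hE
    by_cases hJ : I1 = J
    · subst hJ
      exact ⟨a, haI, ha1, hagree, I1, hE, ha1, .refl⟩
    · obtain ⟨i, hi1, hiJ, hag, I1', hE1, hi1', hR⟩ := ih hJ
      rcases lt_trichotomy i a with h | h | h
      · obtain ⟨I', hE', hiI, hiI', hR'⟩ := swap_lemma hE hE1 haI ha1 hi1 hi1' h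
        exact ⟨i, hiI, hiJ, fun d hd => (hagree d (hd.trans h)).trans (hag d hd), I', hE', hiI',
          hR'.trans hR⟩
      · subst h; exact absurd hi1 ha1
      · exact ⟨a, haI, fun haJ => ha1 ((hag a h).2 haJ),
          fun d hd => (hagree d hd).trans (hag d (hd.trans h)), I1, hE, ha1, reach_of_walk hW⟩

/-- The first label on any walk is at least the least position of disagreement. -/
theorem first_label_ge {I I1 J : Finset (Fin m)} {l : List (Finset (Fin m))} {i : Fin m}
    (hE : FlipEdge cs Q ρ I I1) (hW : DWalk (FlipEdge cs Q ρ) I1 J l)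
    (hag : ∀ d < i, (d ∈ I ↔ d ∈ J)) : (i : ℕ) ≤ pLab I I1 := by
  obtain ⟨a, haI, ha1, hagree, hlab, _⟩ := edge_label hE
  rw [hlab]
  by_contra hlt
  have hlt : a < i := not_le.1 hlt
  have haJ : a ∈ J := (hag a hlt).1 haI
  have hne : I1 ≠ J := by rintro rfl; exact ha1 haJ
  obtain ⟨i1, hi1, hi1J, hag1, _⟩ := first_step hW hne
  rcases lt_trichotomy i1 a with h | h | h
  · exact hi1J ((hag i1 (h.trans hlt)).1 ((hagree i1 h).2 hi1))
  · subst h; exact ha1 hi1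
  · exact ha1 ((hag1 a h).2 haJ)

/-- On a rising walk the first label is the least position of disagreement. -/
theorem rising_first {I J : Finset (Fin m)} {l : List (Finset (Fin m))}
    (h : DWalk (FlipEdge cs Q ρ) I J l) :
    ∀ I1 l1, l = I1 :: l1 → List.IsChain (· < ·) (wLabels pLab I l) →
      ∀ a : Fin m, a ∈ I → a ∉ I1 → a ∉ J ∧ ∀ d < a, (d ∈ I ↔ d ∈ J) := by
  induction h with
  | nil => intro I1 l1 h; simp at h
  | @cons I I1 J l hE hW ih =>
    intro I1' l1 hl hch a ha ha1
    obtain ⟨rfl, rfl⟩ := List.cons.inj hl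
    obtain ⟨a', haI, ha1', hagree, hlab, hun⟩ := edge_label hE
    have := hun a ha ha1
    subst this
    cases hW with
    | nil => exact ⟨ha1, hagree⟩
    | @cons _ I2 _ l hE2 hW2 =>
      obtain ⟨c, hcI, hc2, hagree2, hlab2, _⟩ := edge_label hE2
      have hch' : pLab I I1 < pLab I1 I2 ∧
          List.IsChain (· < ·) (wLabels pLab I1 (I2 :: l)) := by
        simpa [wLabels] using hch
      obtain ⟨_, hag⟩ := ih I2 l rfl hch'.2 c hcI hc2
      have hac : a < c := by
        have := hch'.1
        rw [hlab, hlab2] at this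
        exact this
      exact ⟨fun h => ha1 ((hag a hac).2 h),
        fun d hd => (hagree d hd).trans (hag d (hd.trans hac))⟩

theorem main_aux (J : Finset (Fin m)) (n : ℕ) : ∀ I : Finset (Fin m),
    posSum (Finset.univ : Finset (Fin m)) - posSum I = n →
    (∃ l, DWalk (FlipEdge cs Q ρ) I J l) →
      ∃ l : List (Finset (Fin m)),
        (DWalk (FlipEdge cs Q ρ) I J l ∧ List.IsChain (· < ·) (wLabels pLab I l) ∧
          ∀ l' : List (Finset (Fin m)), DWalk (FlipEdge cs Q ρ) I J l' →
            List.Lex (· < ·) (wLabels pLab I l) (wLabels pLab I l') ∨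
              wLabels pLab I l = wLabels pLab I l') ∧
        ∀ l' : List (Finset (Fin m)),
          DWalk (FlipEdge cs Q ρ) I J l' ∧ List.IsChain (· < ·) (wLabels pLab I l') →
            l' = l := by
  induction n using Nat.strong_induction_on with
  | _ n ih =>
    rintro I hn ⟨l0, hl0⟩
    by_cases hIJ : I = J
    · subst hIJ
      have hnil : ∀ l, DWalk (FlipEdge cs Q ρ) I I l → l = [] := by
        intro l hl
        cases hl with
        | nil => rfl
        | cons hE hW =>
          have h1 := posSum_lt hE
          have h2 := posSum_le_of_walk hW
          omega
      refine ⟨[], ⟨.nil _, by simp [wLabels], ?_⟩, fun l' h => hnil l' h.1⟩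
      intro l' h
      rw [hnil l' h]
      exact Or.inr rfl
    · obtain ⟨i, hiI, hiJ, hag, I', hE, hiI', hR⟩ := first_step hl0 hIJ
      obtain ⟨a, haI, haI', hagree, hlab, hun⟩ := edge_label hE
      have := hun i hiI hiI'
      subst this
      have h1 := posSum_lt hE
      have h2 := posSum_le I'
      obtain ⟨l, ⟨hw, hch, hlex⟩, huni⟩ := ih _ (by omega) I' rfl (exists_walk_of_reach hR)
      refine ⟨I' :: l, ⟨.cons hE hw, ?_, ?_⟩, ?_⟩
      · cases hw with
        | nil => simp [wLabels]
        | @cons _ I2 _ l hE2 hW2 =>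
          obtain ⟨c, hcI, hc2, hagree2, hlab2, _⟩ := edge_label hE2
          obtain ⟨hcJ, hag2⟩ := rising_first (.cons hE2 hW2) I2 l rfl hch c hcI hc2
          have hic : i < c := by
            rcases lt_trichotomy c i with h | h | h
            · exact absurd ((hag c h).1 ((hagree c h).2 hcI)) hcJ
            · subst h; exact absurd hcI hiI'
            · exact h
          have : pLab I I' < pLab I' I2 := by rw [hlab, hlab2]; exact hic
          have hch2 : List.IsChain (· < ·) (pLab I' I2 :: wLabels pLab I2 l) := hch
          show List.IsChain (· < ·) (pLab I I' :: pLab I' I2 :: wLabels pLab I2 l)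
          exact List.isChain_cons_cons.2 ⟨this, hch2⟩
      · intro l' hl'
        cases hl' with
        | nil => exact absurd rfl hIJ
        | @cons _ I1 _ l1 hE1 hW1 =>
          have hge := first_label_ge hE1 hW1 hag
          obtain ⟨c, hcI, hc1, _, hlabc, _⟩ := edge_label hE1
          show List.Lex (· < ·) (pLab I I' :: wLabels pLab I' l) (pLab I I1 :: wLabels pLab I1 l1) ∨
            pLab I I' :: wLabels pLab I' l = pLab I I1 :: wLabels pLab I1 l1
          rcases hge.lt_or_eq with h | h
          · left
            rw [hlab]
            exact List.Lex.rel h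
          · have : i = c := Fin.ext (h.trans hlabc)
            subst this
            have := edge_det hE hE1 hcI hiI' hc1
            subst this
            rcases hlex l1 hW1 with h | h
            · exact Or.inl (List.Lex.cons h)
            · exact Or.inr (by rw [h])
      · rintro l' ⟨hl', hch'⟩
        cases hl' with
        | nil => exact absurd rfl hIJ
        | @cons _ I1 _ l1 hE1 hW1 =>
          obtain ⟨c, hcI, hc1, _, hlabc, _⟩ := edge_label hE1
          obtain ⟨hcJ, hagc⟩ := rising_first (.cons hE1 hW1) I1 l1 rfl hch' c hcI hc1
          have : i = c := by
            rcases lt_trichotomy i c with h | h | h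
            · exact absurd ((hagc i h).1 hiI) hiJ
            · exact h
            · exact absurd ((hag c h).1 hcI) hcJ
          subst this
          have := edge_det hE hE1 hcI hiI' hc1
          subst this
          have hc2 : List.IsChain (· < ·) (pLab I I' :: wLabels pLab I' l1) := hch'
          rw [huni l1 ⟨hW1, hc2.tail⟩]

end Walks

/-- The positive edge labeling of the increasing flip graph of any subword complex is an
EL-labeling: between any two facets related by a directed path there is a unique rising
path, whose label word is lexicographically first among all directed paths. -/
theorem positive_labeling_is_EL {B W : Type*} [Group W] [Finite W]
    {M : CoxeterMatrix B} (cs : CoxeterSystem M W)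
    {m : ℕ} (Q : Fin m → B) (ρ : W) :
    ∀ I J : Finset (Fin m), (∃ l, DWalk (FlipEdge cs Q ρ) I J l) →
      ∃ l : List (Finset (Fin m)),
        (DWalk (FlipEdge cs Q ρ) I J l ∧ List.Chain' (· < ·) (wLabels pLab I l) ∧
          ∀ l' : List (Finset (Fin m)), DWalk (FlipEdge cs Q ρ) I J l' →
            List.Lex (· < ·) (wLabels pLab I l) (wLabels pLab I l') ∨
              wLabels pLab I l = wLabels pLab I l') ∧
        ∀ l' : List (Finset (Fin m)),
          DWalk (FlipEdge cs Q ρ) I J l' ∧ List.Chain' (· < ·) (wLabels pLab I l') →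
            l' = l := by
  intro I J h
  exact main_aux J _ I rfl h
end

section
/- The lexicographically smallest facet of a nonempty subword complex SC(Q,ρ) is the unique source of the increasing flip graph, and the lexicographically largest facet is its unique sink. -/
open scoped Classical

section SubwordHelpers

variable {B W : Type*} [Group W] {M : CoxeterMatrix B} (cs : CoxeterSystem M W)

/-- The involution of `W × ZMod 2` attached to a simple reflection. -/
noncomputable def reflFun (i : B) : Function.End (W × ZMod 2) :=
  fun x => (cs.simple i * x.1 * cs.simple i, x.2 + if x.1 = cs.simple i then 1 else 0)

lemma reflFun_word (ω : List B) (x : W × ZMod 2) :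
    (ω.map (reflFun cs)).prod x =
      (cs.wordProd ω * x.1 * (cs.wordProd ω)⁻¹,
        x.2 + ((cs.rightInvSeq ω).count x.1 : ℕ)) := by
  induction ω with
  | nil =>
    obtain ⟨a, b⟩ := x
    simp
    rfl
  | cons i ω ih =>
    rw [List.map_cons, List.prod_cons]
    change reflFun cs i ((ω.map (reflFun cs)).prod x) = _
    rw [ih]
    have key : (cs.wordProd ω * x.1 * (cs.wordProd ω)⁻¹ = cs.simple i) ↔
        ((cs.wordProd ω)⁻¹ * cs.simple i * cs.wordProd ω = x.1) := by
      constructor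
      · intro h; rw [← h]; group
      · intro h; rw [← h]; group
    simp only [reflFun, CoxeterSystem.rightInvSeq, List.count_cons, CoxeterSystem.wordProd_cons,
      key, beq_iff_eq]
    refine Prod.ext ?_ ?_
    · simp [mul_assoc]
    · push_cast
      simp only [add_assoc, Nat.cast_ite, Nat.cast_one, Nat.cast_zero]

lemma alt_two_mul (i j : B) (n : ℕ) {G : Type*} [Monoid G] (f : B → G) :
    ((CoxeterSystem.alternatingWord i j (2 * n)).map f).prod = (f i * f j) ^ n := by
  induction n with
  | zero => simp [CoxeterSystem.alternatingWord]
  | succ n ih =>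
    rw [show 2 * (n + 1) = 2 * n + 1 + 1 by ring, CoxeterSystem.alternatingWord_succ,
      CoxeterSystem.alternatingWord_succ]
    simp [ih, pow_succ, mul_assoc]

lemma lis_alt (i j : B) :
    cs.leftInvSeq (CoxeterSystem.alternatingWord i j (2 * M i j)) =
      (List.range (M i j)).map (fun k => cs.wordProd (CoxeterSystem.alternatingWord j i (2 * k + 1)))
      ++ (List.range (M i j)).map
        (fun k => cs.wordProd (CoxeterSystem.alternatingWord j i (2 * k + 1))) := by
  apply List.ext_getElem
  · simp; ring
  · intro k h1 h2
    have hk : k < 2 * M i j := by simpa using h1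
    rw [cs.getElem_leftInvSeq_alternatingWord i j _ k hk]
    rw [List.getElem_append]
    split_ifs with h
    · simp
    · simp only [List.getElem_map, List.getElem_range, List.length_map, List.length_range]
      simp only [List.length_map, List.length_range, not_lt] at h
      obtain ⟨c, rfl⟩ := Nat.exists_eq_add_of_le h
      have e1 : ∀ a, (2 * a + 1) / 2 = a := by intro a; omega
      have hn : ∀ a, ¬ Even (2 * a + 1) := by intro a; simp
      have hp : (cs.simple j * cs.simple i) ^ (M i j) = 1 := by
        rw [M.symmetric i j]; exact cs.simple_mul_simple_pow j i
      simp only [CoxeterSystem.prod_alternatingWord_eq_mul_pow, e1, hn, if_false,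
        Nat.add_sub_cancel_left, pow_add, hp, one_mul]

lemma reflFun_liftable : M.IsLiftable (reflFun cs) := by
  intro i j
  rw [← alt_two_mul]
  funext x
  rw [reflFun_word]
  have h1 : cs.wordProd (CoxeterSystem.alternatingWord i j (2 * M i j)) = 1 := by
    rw [CoxeterSystem.prod_alternatingWord_eq_mul_pow]
    simp
  have h2 : List.count x.1 (cs.rightInvSeq (CoxeterSystem.alternatingWord i j (2 * M i j))) =
      List.count x.1 (cs.leftInvSeq (CoxeterSystem.alternatingWord j i (2 * M j i))) := by
    have : CoxeterSystem.alternatingWord i j (2 * M i j) =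
        (CoxeterSystem.alternatingWord j i (2 * M j i)).reverse := by
      rw [M.symmetric j i]
      apply List.ext_getElem
      · simp
      · intro k h1 h2
        have hk : k < 2 * M i j := by simpa using h1
        rw [List.getElem_reverse, CoxeterSystem.getElem_alternatingWord _ _ _ _ hk,
          CoxeterSystem.getElem_alternatingWord _ _ _ _ (by simp; omega)]
        simp only [CoxeterSystem.length_alternatingWord]
        have : Even (2 * M i j + k) ↔ ¬ Even (2 * M i j + (2 * M i j - 1 - k)) := by
          simp only [Nat.even_iff]; omega
        by_cases h : Even (2 * M i j + (2 * M i j - 1 - k)) <;> simp only [this, h] <;> simp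
    rw [this, cs.rightInvSeq_reverse, List.count_reverse]
  rw [h1, h2, lis_alt, List.count_append]
  obtain ⟨a, b⟩ := x
  have : ∀ n : ℕ, ((n + n : ℕ) : ZMod 2) = 0 := by
    intro n
    push_cast
    exact CharTwo.add_self_eq_zero _
  rw [this]
  simp
  rfl

lemma count_ris_eq {ω ω' : List B} (h : cs.wordProd ω = cs.wordProd ω') (t : W) :
    ((cs.rightInvSeq ω).count t : ZMod 2) = ((cs.rightInvSeq ω').count t : ZMod 2) := by
  have key : ∀ ω : List B, cs.lift ⟨reflFun cs, reflFun_liftable cs⟩ (cs.wordProd ω) =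
      (ω.map (reflFun cs)).prod := by
    intro ω
    induction ω with
    | nil => simp
    | cons i ω ih => simp [CoxeterSystem.wordProd_cons, ih, CoxeterSystem.lift_apply_simple]
  have h1 := (key ω).symm.trans ((congrArg _ h).trans (key ω'))
  have h2 := congrFun h1 (t, 0)
  rw [reflFun_word, reflFun_word] at h2
  simpa using congrArg Prod.snd h2

lemma exchange_right {ω : List B} (i : B)
    (h : cs.length (cs.wordProd ω * cs.simple i) < cs.length (cs.wordProd ω)) :
    ∃ k, k < ω.length ∧ cs.wordProd (ω.eraseIdx k) = cs.wordProd ω * cs.simple i := by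
  obtain ⟨ω', hr, hω'⟩ := cs.exists_isReduced (cs.wordProd ω * cs.simple i)
  have hp : cs.wordProd (ω'.concat i) = cs.wordProd ω := by
    rw [CoxeterSystem.wordProd_concat, ← hω']; simp
  have hred : cs.IsReduced (ω'.concat i) := by
    unfold CoxeterSystem.IsReduced at hr ⊢
    rw [hp, List.length_concat, ← hr, ← hω']
    rcases cs.length_mul_simple (cs.wordProd ω) i with h1 | h1 <;> omega
  have hmem : cs.simple i ∈ cs.rightInvSeq (ω'.concat i) := by
    rw [CoxeterSystem.rightInvSeq_concat]; simp
  have hc := List.count_eq_one_of_mem (CoxeterSystem.IsReduced.nodup_rightInvSeq cs hred) hmem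
  have hc2 := count_ris_eq cs hp (cs.simple i)
  rw [hc] at hc2
  have hm : cs.simple i ∈ cs.rightInvSeq ω := by
    by_contra hn
    rw [List.count_eq_zero_of_not_mem hn] at hc2
    simp at hc2
  obtain ⟨k, hk, hk2⟩ := List.getElem_of_mem hm
  refine ⟨k, by simpa using hk, ?_⟩
  rw [← cs.wordProd_mul_getD_rightInvSeq, List.getD_eq_getElem _ _ hk, hk2]

lemma exchange_left {ω : List B} (i : B)
    (h : cs.length (cs.simple i * cs.wordProd ω) < cs.length (cs.wordProd ω)) :
    ∃ k, k < ω.length ∧ cs.wordProd (ω.eraseIdx k) = cs.simple i * cs.wordProd ω := by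
  have h' : cs.length (cs.wordProd ω.reverse * cs.simple i) < cs.length (cs.wordProd ω.reverse) := by
    rw [CoxeterSystem.wordProd_reverse, CoxeterSystem.length_inv, ← cs.length_inv]
    simpa using h
  obtain ⟨k, hk, hk2⟩ := exchange_right cs i h'
  rw [List.length_reverse] at hk
  refine ⟨ω.length - 1 - k, by omega, ?_⟩
  have e : ω.reverse.eraseIdx k = (ω.eraseIdx (ω.length - 1 - k)).reverse := by
    rw [List.eraseIdx_eq_take_drop_succ, List.eraseIdx_eq_take_drop_succ, List.reverse_append,
      List.take_reverse, List.drop_reverse]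
    congr 3 <;> omega
  rw [e, CoxeterSystem.wordProd_reverse, CoxeterSystem.wordProd_reverse] at hk2
  have := congrArg (·⁻¹) hk2
  simpa using this

lemma sort_union_lt {m : ℕ} (A C : Finset (Fin m)) (h : ∀ a ∈ A, ∀ c ∈ C, a < c) :
    (A ∪ C).sort (· ≤ ·) = A.sort (· ≤ ·) ++ C.sort (· ≤ ·) := by
  have hd : Disjoint A C := by
    rw [Finset.disjoint_left]
    intro a ha hc
    exact lt_irrefl _ (h a ha a hc)
  refine List.Perm.eq_of_pairwise (le := (· ≤ ·)) (fun a b _ _ h1 h2 => le_antisymm h1 h2)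
    (Finset.pairwise_sort _ _) ?_ ?_
  · rw [List.pairwise_append]
    refine ⟨Finset.pairwise_sort _ _, Finset.pairwise_sort _ _, ?_⟩
    intro a ha c hc
    exact (h a (by simpa using ha) c (by simpa using hc)).le
  · apply (List.perm_ext_iff_of_nodup (Finset.sort_nodup _ _) ?_).2
    · intro a; simp
    · rw [List.nodup_append]
      refine ⟨Finset.sort_nodup _ _, Finset.sort_nodup _ _, ?_⟩
      intro a ha c hc
      exact (h a (by simpa using ha) c (by simpa using hc)).ne

lemma sort_eraseIdx {m : ℕ} (A : Finset (Fin m)) (k : ℕ) (hk : k < (A.sort (· ≤ ·)).length) :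
    (A.sort (· ≤ ·)).eraseIdx k = (A.erase ((A.sort (· ≤ ·))[k])).sort (· ≤ ·) := by
  have hs : ((A.sort (· ≤ ·)).eraseIdx k).Sublist (A.sort (· ≤ ·)) := List.eraseIdx_sublist _ _
  refine List.Perm.eq_of_pairwise (le := (· ≤ ·)) (fun a b _ _ h1 h2 => le_antisymm h1 h2)
    ((Finset.pairwise_sort A (· ≤ ·)).sublist hs) (Finset.pairwise_sort _ _) ?_
  apply (List.perm_ext_iff_of_nodup ((Finset.sort_nodup A (· ≤ ·)).sublist hs)
    (Finset.sort_nodup _ _)).2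
  intro a
  rw [← List.Nodup.erase_getElem (Finset.sort_nodup A (· ≤ ·)) k hk,
    List.Nodup.mem_erase_iff (Finset.sort_nodup A (· ≤ ·))]
  simp

variable {m : ℕ} (Q : Fin m → B)

/-- Product of the subword at the positions in `A`. -/
noncomputable def subProd (A : Finset (Fin m)) : W := cs.wordProd ((A.sort (· ≤ ·)).map Q)

lemma subProd_union (A C : Finset (Fin m)) (h : ∀ a ∈ A, ∀ c ∈ C, a < c) :
    subProd cs Q (A ∪ C) = subProd cs Q A * subProd cs Q C := by
  simp [subProd, sort_union_lt A C h, CoxeterSystem.wordProd_append]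

lemma subProd_singleton (p : Fin m) : subProd cs Q {p} = cs.simple (Q p) := by
  simp [subProd]

lemma length_subProd_le (A : Finset (Fin m)) : cs.length (subProd cs Q A) ≤ A.card := by
  simpa [subProd] using cs.length_wordProd_le ((A.sort (· ≤ ·)).map Q)

lemma subProd_exchange_right (A : Finset (Fin m)) (i : B)
    (h : cs.length (subProd cs Q A * cs.simple i) < cs.length (subProd cs Q A)) :
    ∃ k ∈ A, subProd cs Q (A.erase k) = subProd cs Q A * cs.simple i := by
  obtain ⟨k, hk, hk2⟩ := exchange_right cs i h
  rw [List.length_map] at hk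
  refine ⟨(A.sort (· ≤ ·))[k], (Finset.mem_sort _).1 (List.getElem_mem hk), ?_⟩
  rw [subProd, ← sort_eraseIdx A k hk, ← List.eraseIdx_map, hk2]
  rfl

lemma subProd_exchange_left (A : Finset (Fin m)) (i : B)
    (h : cs.length (cs.simple i * subProd cs Q A) < cs.length (subProd cs Q A)) :
    ∃ k ∈ A, subProd cs Q (A.erase k) = cs.simple i * subProd cs Q A := by
  obtain ⟨k, hk, hk2⟩ := exchange_left cs i h
  rw [List.length_map] at hk
  refine ⟨(A.sort (· ≤ ·))[k], (Finset.mem_sort _).1 (List.getElem_mem hk), ?_⟩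
  rw [subProd, ← sort_eraseIdx A k hk, ← List.eraseIdx_map, hk2]
  rfl

lemma split_out (A : Finset (Fin m)) (p : Fin m) (hp : p ∉ A) :
    subProd cs Q A = subProd cs Q (A.filter (· < p)) * subProd cs Q (A.filter (p < ·)) ∧
    A.card = (A.filter (· < p)).card + (A.filter (p < ·)).card := by
  have e : A = A.filter (· < p) ∪ A.filter (p < ·) := by
    ext a
    simp only [Finset.mem_union, Finset.mem_filter]
    constructor
    · intro ha
      have : a ≠ p := fun h => hp (h ▸ ha)
      rcases lt_or_gt_of_ne this with h | h <;> simp [ha, h]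
    · tauto
  have hl : ∀ a ∈ A.filter (· < p), ∀ c ∈ A.filter (p < ·), a < c := by
    intro a ha c hc
    exact (Finset.mem_filter.1 ha).2.trans (Finset.mem_filter.1 hc).2
  constructor
  · conv_lhs => rw [e]
    exact subProd_union cs Q _ _ hl
  · conv_lhs => rw [e]
    apply Finset.card_union_of_disjoint
    rw [Finset.disjoint_left]
    intro a ha hc
    exact lt_irrefl _ (hl a ha a hc)

lemma split_in (A : Finset (Fin m)) (p : Fin m) (hp : p ∈ A) :
    subProd cs Q A =
      subProd cs Q (A.filter (· < p)) * cs.simple (Q p) * subProd cs Q (A.filter (p < ·)) ∧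
    A.card = (A.filter (· < p)).card + 1 + (A.filter (p < ·)).card := by
  have e : A = A.filter (· < p) ∪ ({p} ∪ A.filter (p < ·)) := by
    ext a
    simp only [Finset.mem_union, Finset.mem_filter, Finset.mem_singleton]
    constructor
    · intro ha
      rcases lt_trichotomy a p with h | h | h <;> simp [ha, h]
    · rintro (h | h | h)
      · exact h.1
      · exact h ▸ hp
      · exact h.1
  have e2 := split_out cs Q (A.erase p) p (by simp)
  have f1 : (A.erase p).filter (· < p) = A.filter (· < p) := by
    ext a; simp only [Finset.mem_filter, Finset.mem_erase]
    constructor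
    · tauto
    · intro h; exact ⟨⟨h.2.ne, h.1⟩, h.2⟩
  have f2 : (A.erase p).filter (p < ·) = A.filter (p < ·) := by
    ext a; simp only [Finset.mem_filter, Finset.mem_erase]
    constructor
    · tauto
    · intro h; exact ⟨⟨h.2.ne', h.1⟩, h.2⟩
  constructor
  · conv_lhs => rw [e]
    rw [subProd_union, subProd_union, subProd_singleton, mul_assoc]
    · simp
    · intro a ha c hc
      simp only [Finset.mem_union, Finset.mem_filter, Finset.mem_singleton] at ha hc
      rcases hc with rfl | hc
      · exact ha.2
      · exact ha.2.trans hc.2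
  · have := Finset.card_erase_add_one hp
    rw [← this, e2.2, f1, f2]; ring

variable (ρ : W)

lemma exists_flip_in {I₁ I₂ : Finset (Fin m)} (h₁ : IsSCFacet cs Q ρ I₁)
    (h₂ : IsSCFacet cs Q ρ I₂) (p : Fin m) (hp₁ : p ∈ I₁) (hp₂ : p ∉ I₂)
    (hag : ∀ q, p < q → (q ∈ I₁ ↔ q ∈ I₂)) : ∃ J, FlipEdge cs Q ρ J I₁ := by
  have hA := split_out cs Q I₁ᶜ p (by simpa using hp₁)
  have hC := split_in cs Q I₂ᶜ p (by simpa using hp₂)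
  have hF : I₂ᶜ.filter (p < ·) = I₁ᶜ.filter (p < ·) := by
    ext q
    simp only [Finset.mem_filter, Finset.mem_compl]
    constructor <;> rintro ⟨h, h'⟩ <;> have := hag q h' <;> tauto
  rw [hF] at hC
  have w₁ : subProd cs Q I₁ᶜ = ρ := h₁.1
  have w₂ : subProd cs Q I₂ᶜ = ρ := h₂.1
  have c₁ := h₁.2
  have c₂ := h₂.2
  have hσ : subProd cs Q (I₁ᶜ.filter (· < p)) * cs.simple (Q p) =
      subProd cs Q (I₂ᶜ.filter (· < p)) := by
    have := hA.1.symm.trans (w₁.trans (w₂.symm.trans hC.1))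
    rw [mul_left_inj] at this
    rw [this]; simp
  have l1 := cs.length_mul_le (subProd cs Q (I₁ᶜ.filter (· < p))) (subProd cs Q (I₁ᶜ.filter (p < ·)))
  rw [← hA.1, w₁] at l1
  have l2 := length_subProd_le cs Q (I₁ᶜ.filter (p < ·))
  have l3 := length_subProd_le cs Q (I₂ᶜ.filter (· < p))
  obtain ⟨k, hk, hk2⟩ := subProd_exchange_right cs Q (I₁ᶜ.filter (· < p)) (Q p) (by
    rw [hσ]; omega)
  rw [Finset.mem_filter, Finset.mem_compl] at hk
  have hJc : (insert k (I₁.erase p))ᶜ.card = I₁ᶜ.card := by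
    rw [Finset.card_compl, Finset.card_compl, Finset.card_insert_of_notMem (by simp [hk.1]),
      Finset.card_erase_add_one hp₁]
  have hpJ : p ∈ (insert k (I₁.erase p))ᶜ := by
    simp [hk.2.ne']
  have hJ := split_in cs Q (insert k (I₁.erase p))ᶜ p hpJ
  have g1 : (insert k (I₁.erase p))ᶜ.filter (· < p) = (I₁ᶜ.filter (· < p)).erase k := by
    ext a
    simp only [Finset.mem_filter, Finset.mem_erase, Finset.mem_compl, Finset.mem_insert]
    have : a < p → a ≠ p := fun h => h.ne
    tauto
  have g2 : (insert k (I₁.erase p))ᶜ.filter (p < ·) = I₁ᶜ.filter (p < ·) := by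
    ext a
    simp only [Finset.mem_filter, Finset.mem_erase, Finset.mem_compl, Finset.mem_insert]
    have : p < a → a ≠ p := fun h => h.ne'
    have : p < a → a ≠ k := fun h => (hk.2.trans h).ne'
    tauto
  refine ⟨insert k (I₁.erase p), ⟨?_, by rw [hJc, c₁]⟩, h₁, k, by simp, p, hp₁, hk.2, ?_⟩
  · change subProd cs Q _ = ρ
    rw [hJ.1, g1, g2, hk2, ← w₁, hA.1]
    simp
  · rw [Finset.erase_insert (by simp [hk.1])]

lemma exists_flip_out {I₁ I₂ : Finset (Fin m)} (h₁ : IsSCFacet cs Q ρ I₁)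
    (h₂ : IsSCFacet cs Q ρ I₂) (p : Fin m) (hp₁ : p ∈ I₁) (hp₂ : p ∉ I₂)
    (hag : ∀ q, q < p → (q ∈ I₁ ↔ q ∈ I₂)) : ∃ J, FlipEdge cs Q ρ I₁ J := by
  have hA := split_out cs Q I₁ᶜ p (by simpa using hp₁)
  have hC := split_in cs Q I₂ᶜ p (by simpa using hp₂)
  have hF : I₂ᶜ.filter (· < p) = I₁ᶜ.filter (· < p) := by
    ext q
    simp only [Finset.mem_filter, Finset.mem_compl]
    constructor <;> rintro ⟨h, h'⟩ <;> have := hag q h' <;> tauto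
  rw [hF] at hC
  have w₁ : subProd cs Q I₁ᶜ = ρ := h₁.1
  have w₂ : subProd cs Q I₂ᶜ = ρ := h₂.1
  have c₁ := h₁.2
  have c₂ := h₂.2
  have hσ : cs.simple (Q p) * subProd cs Q (I₁ᶜ.filter (p < ·)) =
      subProd cs Q (I₂ᶜ.filter (p < ·)) := by
    have := hA.1.symm.trans (w₁.trans (w₂.symm.trans hC.1))
    rw [mul_assoc, mul_right_inj] at this
    rw [this]; simp
  have l1 := cs.length_mul_le (subProd cs Q (I₁ᶜ.filter (· < p))) (subProd cs Q (I₁ᶜ.filter (p < ·)))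
  rw [← hA.1, w₁] at l1
  have l2 := length_subProd_le cs Q (I₁ᶜ.filter (· < p))
  have l3 := length_subProd_le cs Q (I₂ᶜ.filter (p < ·))
  obtain ⟨k, hk, hk2⟩ := subProd_exchange_left cs Q (I₁ᶜ.filter (p < ·)) (Q p) (by
    rw [hσ]; omega)
  rw [Finset.mem_filter, Finset.mem_compl] at hk
  have hJc : (insert k (I₁.erase p))ᶜ.card = I₁ᶜ.card := by
    rw [Finset.card_compl, Finset.card_compl, Finset.card_insert_of_notMem (by simp [hk.1]),
      Finset.card_erase_add_one hp₁]
  have hpJ : p ∈ (insert k (I₁.erase p))ᶜ := by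
    simp [hk.2.ne]
  have hJ := split_in cs Q (insert k (I₁.erase p))ᶜ p hpJ
  have g1 : (insert k (I₁.erase p))ᶜ.filter (p < ·) = (I₁ᶜ.filter (p < ·)).erase k := by
    ext a
    simp only [Finset.mem_filter, Finset.mem_erase, Finset.mem_compl, Finset.mem_insert]
    have : p < a → a ≠ p := fun h => h.ne'
    tauto
  have g2 : (insert k (I₁.erase p))ᶜ.filter (· < p) = I₁ᶜ.filter (· < p) := by
    ext a
    simp only [Finset.mem_filter, Finset.mem_erase, Finset.mem_compl, Finset.mem_insert]
    have : a < p → a ≠ p := fun h => h.ne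
    have : a < p → a ≠ k := fun h => (h.trans hk.2).ne
    tauto
  refine ⟨insert k (I₁.erase p), h₁, ⟨?_, by rw [hJc, c₁]⟩, p, hp₁, k, by simp, hk.2, ?_⟩
  · change subProd cs Q _ = ρ
    rw [hJ.1, g1, g2, hk2, ← w₁, hA.1]
    simp [mul_assoc]
  · rw [Finset.erase_insert (by simp [hk.1])]

lemma source_unique {I₁ I₂ : Finset (Fin m)} (h₁ : IsSCFacet cs Q ρ I₁)
    (h₂ : IsSCFacet cs Q ρ I₂) (s₁ : ∀ J, ¬FlipEdge cs Q ρ J I₁)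
    (s₂ : ∀ J, ¬FlipEdge cs Q ρ J I₂) : I₁ = I₂ := by
  by_contra hne
  have hn : (symmDiff I₁ I₂).Nonempty := by
    rw [Finset.nonempty_iff_ne_empty]
    intro h
    exact hne (symmDiff_eq_bot.1 h)
  have hmem := Finset.max'_mem _ hn
  have hag : ∀ q, (symmDiff I₁ I₂).max' hn < q → (q ∈ I₁ ↔ q ∈ I₂) := by
    intro q hq
    by_contra hc
    have : q ∈ symmDiff I₁ I₂ := by rw [Finset.mem_symmDiff]; tauto
    exact absurd (Finset.le_max' _ q this) (not_le.2 hq)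
  generalize (symmDiff I₁ I₂).max' hn = p at hmem hag
  rw [Finset.mem_symmDiff] at hmem
  rcases hmem with ⟨a, b⟩ | ⟨a, b⟩
  · obtain ⟨J, hJ⟩ := exists_flip_in cs Q ρ h₁ h₂ p a b hag
    exact s₁ J hJ
  · obtain ⟨J, hJ⟩ := exists_flip_in cs Q ρ h₂ h₁ p a b (fun q hq => (hag q hq).symm)
    exact s₂ J hJ

lemma sink_unique_s14 {I₁ I₂ : Finset (Fin m)} (h₁ : IsSCFacet cs Q ρ I₁)
    (h₂ : IsSCFacet cs Q ρ I₂) (s₁ : ∀ J, ¬FlipEdge cs Q ρ I₁ J)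
    (s₂ : ∀ J, ¬FlipEdge cs Q ρ I₂ J) : I₁ = I₂ := by
  by_contra hne
  have hn : (symmDiff I₁ I₂).Nonempty := by
    rw [Finset.nonempty_iff_ne_empty]
    intro h
    exact hne (symmDiff_eq_bot.1 h)
  have hmem := Finset.min'_mem _ hn
  have hag : ∀ q, q < (symmDiff I₁ I₂).min' hn → (q ∈ I₁ ↔ q ∈ I₂) := by
    intro q hq
    by_contra hc
    have : q ∈ symmDiff I₁ I₂ := by rw [Finset.mem_symmDiff]; tauto
    exact absurd (Finset.min'_le _ q this) (not_le.2 hq)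
  generalize (symmDiff I₁ I₂).min' hn = p at hmem hag
  rw [Finset.mem_symmDiff] at hmem
  rcases hmem with ⟨a, b⟩ | ⟨a, b⟩
  · obtain ⟨J, hJ⟩ := exists_flip_out cs Q ρ h₁ h₂ p a b hag
    exact s₁ J hJ
  · obtain ⟨J, hJ⟩ := exists_flip_out cs Q ρ h₂ h₁ p a b (fun q hq => (hag q hq).symm)
    exact s₂ J hJ

lemma lex_of_flip {I J : Finset (Fin m)} {i j : Fin m} (hi : i ∈ I) (hj : j ∈ J) (hij : i < j)
    (he : I.erase i = J.erase j) :
    I ≠ J ∧ List.Lex (· < ·) (I.sort (· ≤ ·)) (J.sort (· ≤ ·)) := by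
  have hiJ : i ∉ J := by
    intro h
    have : i ∈ J.erase j := Finset.mem_erase.2 ⟨hij.ne, h⟩
    rw [← he] at this
    simp at this
  have hmem : ∀ a, a ≠ i → a ≠ j → (a ∈ I ↔ a ∈ J) := by
    intro a h1 h2
    have := Finset.ext_iff.1 he a
    simpa [h1, h2] using this
  refine ⟨fun h => hiJ (h ▸ hi), ?_⟩
  have eI : I = I.filter (· < i) ∪ ({i} ∪ I.filter (i < ·)) := by
    ext a
    simp only [Finset.mem_union, Finset.mem_filter, Finset.mem_singleton]
    rcases lt_trichotomy a i with h | h | h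
    · simp [h, h.ne, h.not_gt]
    · simp [h, hi]
    · simp [h, h.ne', h.not_gt]
  have eJ : J = I.filter (· < i) ∪ J.filter (i < ·) := by
    ext a
    simp only [Finset.mem_union, Finset.mem_filter]
    rcases lt_trichotomy a i with h | h | h
    · simp [h, h.not_gt, hmem a h.ne (h.trans hij).ne]
    · simp [h, hiJ]
    · simp [h, h.not_gt]
  rw [eI, eJ, sort_union_lt, sort_union_lt, sort_union_lt]
  · apply List.Lex.append_left
    have hjm : j ∈ (J.filter (i < ·)).sort (· ≤ ·) := by simp [hj, hij]
    have hall : ∀ a ∈ (J.filter (i < ·)).sort (· ≤ ·), i < a := by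
      intro a ha
      simp at ha; exact ha.2
    cases hL : (J.filter (i < ·)).sort (· ≤ ·) with
    | nil => rw [hL] at hjm; simp at hjm
    | cons b L =>
      rw [Finset.sort_singleton]
      exact List.Lex.rel (hall b (by rw [hL]; simp))
  · intro a ha c hc
    simp only [Finset.mem_filter] at ha hc
    exact ha.2.trans hc.2
  · intro a ha c hc
    simp only [Finset.mem_filter, Finset.mem_singleton] at ha hc
    subst ha; exact hc.2
  · intro a ha c hc
    simp only [Finset.mem_union, Finset.mem_filter, Finset.mem_singleton] at ha hc
    rcases hc with rfl | hc
    · exact ha.2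
    · exact ha.2.trans hc.2

lemma lex_absurd {I J : Finset (Fin m)}
    (h1 : List.Lex (· < ·) (I.sort (· ≤ ·)) (J.sort (· ≤ ·)))
    (h2 : List.Lex (· < ·) (J.sort (· ≤ ·)) (I.sort (· ≤ ·))) : False := by
  have a : I.sort (· ≤ ·) < J.sort (· ≤ ·) := h1
  have b : J.sort (· ≤ ·) < I.sort (· ≤ ·) := h2
  exact lt_asymm a b

end SubwordHelpers

/-- The lexicographically smallest facet of a nonempty subword complex is the unique
source of the increasing flip graph, and the lexicographically largest facet is its
unique sink. -/
theorem lex_smallest_unique_source_and_largest_unique_sink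
    {B W : Type*} [Group W] [Finite W]
    {M : CoxeterMatrix B} (cs : CoxeterSystem M W)
    {m : ℕ} (Q : Fin m → B) (ρ : W) (hne : ∃ I, IsSCFacet cs Q ρ I) :
    (∀ P : Finset (Fin m), IsSCFacet cs Q ρ P →
      (∀ I, IsSCFacet cs Q ρ I → I ≠ P →
        List.Lex (· < ·) (P.sort (· ≤ ·)) (I.sort (· ≤ ·))) →
      ((∀ J, ¬FlipEdge cs Q ρ J P) ∧
        ∀ I, IsSCFacet cs Q ρ I → (∀ J, ¬FlipEdge cs Q ρ J I) → I = P)) ∧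
    (∀ N : Finset (Fin m), IsSCFacet cs Q ρ N →
      (∀ I, IsSCFacet cs Q ρ I → I ≠ N →
        List.Lex (· < ·) (I.sort (· ≤ ·)) (N.sort (· ≤ ·))) →
      ((∀ J, ¬FlipEdge cs Q ρ N J) ∧
        ∀ I, IsSCFacet cs Q ρ I → (∀ J, ¬FlipEdge cs Q ρ I J) → I = N)) := by
  refine ⟨fun P hP hmin => ?_, fun N hN hmax => ?_⟩
  · have hs : ∀ J, ¬FlipEdge cs Q ρ J P := by
      rintro J ⟨hJ, -, i, hi, j, hj, hij, he⟩
      obtain ⟨hne', hl⟩ := lex_of_flip hi hj hij he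
      exact lex_absurd hl (hmin J hJ hne')
    exact ⟨hs, fun I hI hIs => source_unique cs Q ρ hI hP hIs hs⟩
  · have hs : ∀ J, ¬FlipEdge cs Q ρ N J := by
      rintro J ⟨-, hJ, i, hi, j, hj, hij, he⟩
      obtain ⟨hne', hl⟩ := lex_of_flip hi hj hij he
      exact lex_absurd hl (hmax J hJ hne'.symm)
    exact ⟨hs, fun I hI hIs => sink_unique_s14 cs Q ρ hI hN hIs hs⟩
end

section
/- Let SC(Q,ρ) be a spherical subword complex (every position of every facet is flippable). Starting from the unique source facet P of the increasing flip graph and successively flipping all positions of P in decreasing order yields a well-defined path of increasing flips ending at the unique sink facet N. In particular, there is a positive-falling path from P to N. -/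
open scoped Classical

section Helpers

variable {B W : Type*} [Group W] {M : CoxeterMatrix B} (cs : CoxeterSystem M W)
  {m : ℕ} (Q : Fin m → B)

/-- letter at position `n` of the complement of `I` (or `1`) -/
noncomputable def gLet (I : Finset (Fin m)) (n : ℕ) : W :=
  if h : n < m then (if (⟨n, h⟩ : Fin m) ∈ I then 1 else cs.simple (Q ⟨n, h⟩)) else 1

/-- prefix products -/
noncomputable def preP (I : Finset (Fin m)) (n : ℕ) : W :=
  ((List.range n).map (gLet cs Q I)).prod

/-- the reflection attached to the position `k` -/
noncomputable def scRefl (I : Finset (Fin m)) (k : Fin m) : W :=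
  preP cs Q I k * cs.simple (Q k) * (preP cs Q I k)⁻¹

lemma preP_succ (I : Finset (Fin m)) (n : ℕ) :
    preP cs Q I (n + 1) = preP cs Q I n * gLet cs Q I n := by
  simp [preP, List.range_succ]

lemma refl_sq (I : Finset (Fin m)) (k : Fin m) : scRefl cs Q I k * scRefl cs Q I k = 1 := by
  simp [scRefl, mul_assoc]

lemma preP_total (I : Finset (Fin m)) :
    preP cs Q I m = cs.wordProd ((Iᶜ.sort (· ≤ ·)).map Q) := by
  have h1 : Iᶜ.sort (· ≤ ·) = (List.finRange m).filter (fun k => decide (k ∉ I)) := by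
    apply List.Perm.eq_of_pairwise (le := (· ≤ ·))
    · intro a b _ _ h1 h2; exact le_antisymm h1 h2
    · exact Finset.pairwise_sort _ _
    · exact (List.pairwise_le_finRange m).filter _
    · rw [List.perm_ext_iff_of_nodup (Finset.sort_nodup _ _) ((List.nodup_finRange m).filter _)]
      intro a; simp
  rw [h1, preP, ← List.map_coe_finRange_eq_range]
  generalize List.finRange m = L
  induction L with
  | nil => simp
  | cons a L ih =>
    by_cases ha : a ∈ I
    · simpa [ha, gLet] using ih
    · simpa [ha, gLet, CoxeterSystem.wordProd_cons] using ih

lemma preP_insert_le (I : Finset (Fin m)) (x : Fin m) (n : ℕ) (hn : n ≤ x) :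
    preP cs Q (insert x I) n = preP cs Q I n := by
  induction n with
  | zero => simp [preP]
  | succ n ih =>
    rw [preP_succ, preP_succ, ih (by omega)]
    congr 1
    have : ∀ h : n < m, (⟨n, h⟩ : Fin m) ≠ x := by
      intro h e; subst e; simp at hn
    unfold gLet
    split_ifs <;> simp_all

lemma preP_insert_gt (I : Finset (Fin m)) (x : Fin m) (hx : x ∉ I) (n : ℕ) (hn : x < n) :
    preP cs Q (insert x I) n = scRefl cs Q I x * preP cs Q I n := by
  induction n with
  | zero => omega
  | succ n ih =>
    rw [preP_succ, preP_succ]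
    rcases Nat.lt_or_ge x n with h | h
    · rw [ih h, mul_assoc]
      congr 2
      have : ∀ h : n < m, (⟨n, h⟩ : Fin m) ≠ x := by
        intro h e; subst e; simp at h
      unfold gLet
      split_ifs <;> simp_all
    · have : n = x := by omega
      subst this
      rw [preP_insert_le _ _ _ _ _ le_rfl]
      simp [gLet, hx, scRefl, mul_assoc]

lemma refl_insert_le (I : Finset (Fin m)) (x k : Fin m) (hk : k ≤ x) :
    scRefl cs Q (insert x I) k = scRefl cs Q I k := by
  simp only [scRefl]
  rw [preP_insert_le cs Q I x k hk]

lemma refl_insert_gt (I : Finset (Fin m)) (x k : Fin m) (hx : x ∉ I) (hk : x < k) :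
    scRefl cs Q (insert x I) k = scRefl cs Q I x * scRefl cs Q I k * scRefl cs Q I x := by
  have h : (scRefl cs Q I x)⁻¹ = scRefl cs Q I x := inv_eq_of_mul_eq_one_left (refl_sq cs Q I x)
  have e : scRefl cs Q (insert x I) k = preP cs Q (insert x I) k * cs.simple (Q k) *
    (preP cs Q (insert x I) k)⁻¹ := rfl
  have e' : scRefl cs Q I k = preP cs Q I k * cs.simple (Q k) *
    (preP cs Q I k)⁻¹ := rfl
  rw [e, e', preP_insert_gt cs Q I x hx k hk, mul_inv_rev, h]
  simp only [mul_assoc]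

/-- `A ∪ i` and `A ∪ x` both facets: same reflection. -/
lemma flip_core {ρ : W} (A : Finset (Fin m)) (i x : Fin m) (hi : i ∉ A) (hx : x ∉ A)
    (h1 : IsSCFacet cs Q ρ (insert i A)) (h2 : IsSCFacet cs Q ρ (insert x A)) :
    scRefl cs Q A i = scRefl cs Q A x := by
  have e1 := h1.1
  have e2 := h2.1
  rw [← preP_total, preP_insert_gt cs Q A _ (by assumption) m (Fin.is_lt _)] at e1 e2
  exact mul_right_cancel (e1.trans e2.symm)

lemma flip_refl {ρ : W} (A : Finset (Fin m)) (i x : Fin m) (hi : i ∉ A) (hx : x ∉ A)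
    (h1 : IsSCFacet cs Q ρ (insert i A)) (h2 : IsSCFacet cs Q ρ (insert x A)) :
    scRefl cs Q (insert i A) i = scRefl cs Q (insert i A) x := by
  have h := flip_core cs Q A i x hi hx h1 h2
  rw [refl_insert_le _ _ _ _ _ le_rfl]
  rcases lt_or_ge i x with hl | hl
  · rw [refl_insert_gt _ _ _ _ _ hi hl, ← h, refl_sq, one_mul]
  · rw [refl_insert_le _ _ _ _ _ hl, h]

lemma refl_distinct_aux {ρ : W} (I : Finset (Fin m)) (h : IsSCFacet cs Q ρ I) (x y : Fin m)
    (hx : x ∉ I) (hy : y ∉ I) (hxy : x < y) : scRefl cs Q I x ≠ scRefl cs Q I y := by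
  intro e
  have hx' : x ∉ insert y I := by simp [hx, hxy.ne]
  have h1 : preP cs Q (insert x (insert y I)) m = ρ := by
    rw [preP_insert_gt _ _ _ _ hx' _ x.is_lt, preP_insert_gt _ _ _ _ hy _ y.is_lt,
      refl_insert_le _ _ _ _ _ hxy.le, e, ← mul_assoc, refl_sq, one_mul, preP_total, h.1]
  rw [preP_total] at h1
  have h2 := cs.length_wordProd_le (((insert x (insert y I))ᶜ.sort (· ≤ ·)).map Q)
  rw [h1, List.length_map, Finset.length_sort, ← h.2] at h2
  have h3 : (insert x (insert y I))ᶜ ⊂ Iᶜ := by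
    rw [Finset.ssubset_iff_of_subset]
    · exact ⟨x, by simp [hx], by simp⟩
    · intro z; simp
  have := Finset.card_lt_card h3
  omega

lemma refl_inj {ρ : W} (I : Finset (Fin m)) (h : IsSCFacet cs Q ρ I) (x y : Fin m)
    (hx : x ∉ I) (hy : y ∉ I) (e : scRefl cs Q I x = scRefl cs Q I y) : x = y := by
  rcases lt_trichotomy x y with hl | hl | hl
  · exact absurd e (refl_distinct_aux cs Q I h x y hx hy hl)
  · exact hl
  · exact absurd e.symm (refl_distinct_aux cs Q I h y x hy hx hl)

lemma flip_shape {I K : Finset (Fin m)} {i x : Fin m} (hi : i ∈ I) (hx : x ∈ K) (hne : i ≠ x)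
    (h : I.erase i = K.erase x) : x ∉ I ∧ i ∉ K ∧ ∀ z, z ≠ i → z ≠ x → (z ∈ I ↔ z ∈ K) := by
  have key : ∀ z, (z ≠ i ∧ z ∈ I) ↔ (z ≠ x ∧ z ∈ K) := by
    intro z
    have := Finset.ext_iff.1 h z
    simpa using this
  refine ⟨fun hh => ?_, fun hh => ?_, fun z h1 h2 => ?_⟩
  · exact ((key x).1 ⟨hne.symm, hh⟩).1 rfl
  · exact ((key i).2 ⟨hne, hh⟩).1 rfl
  · have := key z; tauto

/-- F1 -/
lemma flip_refl' {ρ : W} {I K : Finset (Fin m)} {i x : Fin m} (hi : i ∈ I) (hx : x ∈ K)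
    (hne : i ≠ x) (h : I.erase i = K.erase x)
    (h1 : IsSCFacet cs Q ρ I) (h2 : IsSCFacet cs Q ρ K) :
    scRefl cs Q I i = scRefl cs Q I x := by
  have := flip_refl cs Q (ρ := ρ) (I.erase i) i x (by simp) (by rw [h]; simp)
    (by rwa [Finset.insert_erase hi]) (by rwa [h, Finset.insert_erase hx])
  rwa [Finset.insert_erase hi] at this

/-- F3 -/
lemma flip_change {ρ : W} {I K : Finset (Fin m)} {i x : Fin m} (hi : i ∈ I) (hx : x ∈ K)
    (hlt : i < x) (h : I.erase i = K.erase x)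
    (h1 : IsSCFacet cs Q ρ I) (h2 : IsSCFacet cs Q ρ K) :
    (∀ k, x < k → scRefl cs Q K k = scRefl cs Q I k) ∧
    (∀ k, i < k → k ≤ x → scRefl cs Q K k = scRefl cs Q I i * scRefl cs Q I k * scRefl cs Q I i) := by
  have hiA : i ∉ I.erase i := by simp
  have hxA : x ∉ I.erase i := by rw [h]; simp
  have eI := Finset.insert_erase hi
  have eK : insert x (I.erase i) = K := by rw [h, Finset.insert_erase hx]
  generalize I.erase i = A at *
  subst eI eK
  have hc := flip_core cs Q A i x hiA hxA h1 h2
  refine ⟨fun k hk => ?_, fun k hk hk' => ?_⟩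
  · rw [refl_insert_gt _ _ _ _ _ hxA hk, refl_insert_gt _ _ _ _ _ hiA (hlt.trans hk), hc]
  · rw [refl_insert_le _ _ _ _ _ hk', refl_insert_gt _ _ _ _ _ hiA hk,
      refl_insert_le _ _ _ _ _ le_rfl]
    have := refl_sq cs Q A i
    simp only [mul_assoc, this, mul_one]
    rw [← mul_assoc, this, one_mul]

/-- weight encoding the lexicographic order -/
def lexW (K : Finset (Fin m)) : ℕ := ∑ k ∈ K, 2 ^ (m - k.val)

lemma lexW_lt (S : Finset (Fin m)) (y : Fin m) (h : ∀ k ∈ S, y < k) :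
    lexW S < 2 ^ (m - y.val) := by
  have : lexW S = ∑ n ∈ S.image (fun k : Fin m => m - k.val), 2 ^ n := by
    rw [Finset.sum_image]
    · rfl
    · intro a _ b _ e
      simp at e
      ext
      have := a.is_lt
      have := b.is_lt
      omega
  rw [this]
  apply Nat.geomSum_lt le_rfl
  intro k hk
  obtain ⟨a, ha, rfl⟩ := Finset.mem_image.1 hk
  have := h a ha
  have := a.is_lt
  have : y.val < a.val := h a ha
  omega

lemma lexW_max {ρ : W} (P : Finset (Fin m))
    (hPuniq : ∀ I, IsSCFacet cs Q ρ I → (∀ J, ¬FlipEdge cs Q ρ J I) → I = P)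
    (K : Finset (Fin m)) (hK : IsSCFacet cs Q ρ K) : lexW K ≤ lexW P := by
  obtain ⟨I, hI, hmax⟩ := Finset.exists_max_image
    (Finset.univ.filter (fun I : Finset (Fin m) => IsSCFacet cs Q ρ I)) lexW ⟨K, by simpa using hK⟩
  simp only [Finset.mem_filter, Finset.mem_univ, true_and] at hI hmax
  have : I = P := by
    apply hPuniq I hI
    rintro J ⟨hJ, -, i, hi, j, hj, hij, e⟩
    have h1 := hmax J hJ
    have e1 : lexW J = lexW (J.erase i) + 2 ^ (m - i.val) := (Finset.sum_erase_add _ _ hi).symm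
    have e2 : lexW I = lexW (I.erase j) + 2 ^ (m - j.val) := (Finset.sum_erase_add _ _ hj).symm
    have : 2 ^ (m - j.val) < 2 ^ (m - i.val) := by
      apply Nat.pow_lt_pow_right (by norm_num)
      have := j.is_lt
      have : i.val < j.val := hij
      omega
    rw [e] at e1
    omega
  exact this ▸ hmax K hK

lemma lex_contra {ρ : W} (P : Finset (Fin m))
    (hPuniq : ∀ I, IsSCFacet cs Q ρ I → (∀ J, ¬FlipEdge cs Q ρ J I) → I = P)
    (K : Finset (Fin m)) (hK : IsSCFacet cs Q ρ K) (y : Fin m) (hyK : y ∈ K) (hyP : y ∉ P)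
    (hsub : ∀ p ∈ P, p < y → p ∈ K) : False := by
  have h := lexW_max cs Q P hPuniq K hK
  have h1 : lexW P = lexW (P.filter (· < y)) + lexW (P.filter (¬ · < y)) :=
    (Finset.sum_filter_add_sum_filter_not _ _ _).symm
  have h2 : lexW (P.filter (¬ · < y)) < 2 ^ (m - y.val) := by
    apply lexW_lt
    intro k hk
    simp only [Finset.mem_filter, not_lt] at hk
    refine lt_of_le_of_ne hk.2 ?_
    rintro rfl
    exact hyP hk.1
  have h3 : lexW (insert y (P.filter (· < y))) ≤ lexW K := by
    apply Finset.sum_le_sum_of_subset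
    intro z hz
    simp only [Finset.mem_insert, Finset.mem_filter] at hz
    rcases hz with rfl | hz
    · exact hyK
    · exact hsub z hz.1 hz.2
  have h4 : lexW (insert y (P.filter (· < y))) = 2 ^ (m - y.val) + lexW (P.filter (· < y)) :=
    Finset.sum_insert (by simp)
  omega

lemma greedy_aux {ρ : W}
    (hsph : ∀ I : Finset (Fin m), IsSCFacet cs Q ρ I → ∀ i ∈ I,
      ∃ (J : Finset (Fin m)) (j : Fin m), IsSCFacet cs Q ρ J ∧ j ∈ J ∧
        I.erase i = J.erase j ∧ I ≠ J)
    (P N : Finset (Fin m))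
    (hPuniq : ∀ I, IsSCFacet cs Q ρ I → (∀ J, ¬FlipEdge cs Q ρ J I) → I = P)
    (hNuniq : ∀ I, IsSCFacet cs Q ρ I → (∀ J, ¬FlipEdge cs Q ρ I J) → I = N)
    (L : List (Fin m)) (hL : L.Pairwise (· > ·))
    (hLP : ∀ p ∈ P, p ∉ L → ∀ q ∈ L, q < p) (I : Finset (Fin m)) (hI : IsSCFacet cs Q ρ I)
    (hLI : ∀ q ∈ L, q ∈ I)
    (hinv : ∀ i ∈ I, i ∉ L → (∀ q ∈ L, q < i) ∧
      ∀ (K : Finset (Fin m)) (x : Fin m), IsSCFacet cs Q ρ K → x ∈ K → i < x →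
        I.erase i = K.erase x → False) :
    ∃ l : List (Finset (Fin m)), DWalk (FlipEdge cs Q ρ) I N l ∧
      wLabels pLab I l = L.map Fin.val := by
  induction L generalizing I with
  | nil =>
    have : I = N := by
      apply hNuniq I hI
      rintro J ⟨-, hJ, i, hi, j, hj, hij, e⟩
      exact (hinv i hi (by simp)).2 J j hJ hj hij e
    subst this
    exact ⟨[], DWalk.nil _, by simp [wLabels]⟩
  | cons a L ih =>
    rw [List.pairwise_cons] at hL
    obtain ⟨haL, hL⟩ := hL
    have haI : a ∈ I := hLI a (by simp)
    -- a flip `i → y` of a facet with `y < a` is impossible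
    have low : ∀ (i y : Fin m) (K : Finset (Fin m)), i ∈ I → IsSCFacet cs Q ρ K → y ∈ K → i ≠ y →
        I.erase i = K.erase y → a ≤ i → y < a → False := by
      intro i y K hi hK hy hne e hai hya
      obtain ⟨s1, s2, s3⟩ := flip_shape hi hy hne e
      have hp : ∀ p ∈ P, p < a → p ∈ I := by
        intro p hp hpa
        by_contra hpI
        have : p ∉ a :: L := fun h => hpI (hLI p h)
        exact absurd (hLP p hp this a (by simp)) (not_lt.2 hpa.le)
      apply lex_contra cs Q P hPuniq K hK y hy
      · intro h; exact s1 (hp y h hya)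
      · intro p h1 h2
        have h3 := hp p h1 (h2.trans hya)
        exact (s3 p (ne_of_lt ((h2.trans hya).trans_le hai)) h2.ne).1 h3
    obtain ⟨K, j, hK, hjK, e, hne⟩ := hsph I hI a haI
    have haj : a ≠ j := by
      rintro rfl
      apply hne
      rw [← Finset.insert_erase haI, e, Finset.insert_erase hjK]
    have hlt : a < j := by
      rcases lt_or_ge a j with h | h
      · exact h
      · exact (low a j K haI hK hjK haj e le_rfl (lt_of_le_of_ne h haj.symm)).elim
    obtain ⟨s1, s2, s3⟩ := flip_shape haI hjK haj e
    obtain ⟨c1, c2⟩ := flip_change cs Q haI hjK hlt e hI hK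
    obtain ⟨l, hw, hl⟩ := ih hL (by
        intro p hp hpL q hq
        by_cases hpa : p = a
        · subst hpa; exact haL q hq
        · exact hLP p hp (by simp [hpa, hpL]) q (by simp [hq])) K hK (by
        intro q hq
        have hqa : q < a := haL q hq
        exact (s3 q hqa.ne (hqa.trans hlt).ne).1 (hLI q (by simp [hq]))) (by
        intro i hi hiL
        have hia : i ≠ a := by rintro rfl; exact s2 hi
        by_cases hij : i = j
        · subst hij
          refine ⟨fun q hq => lt_trans (haL q hq) hlt, ?_⟩
          intro K' x hK' hx hix e'
          have r1 := flip_refl' cs Q hi haI haj.symm e.symm hK hI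
          have r2 := flip_refl' cs Q hi hx hix.ne e' hK hK'
          have s' := flip_shape hi hx hix.ne e'
          have := refl_inj cs Q K hK a x s2 s'.1 (r1.symm.trans r2)
          exact absurd (this ▸ hlt.trans hix) (lt_irrefl _)
        · have hiI : i ∈ I := (s3 i hia hij).2 hi
          obtain ⟨v1, v2⟩ := hinv i hiI (by simp [hia, hiL])
          refine ⟨fun q hq => v1 q (by simp [hq]), ?_⟩
          intro K' x hK' hx hix e'
          have hai : a < i := v1 a (by simp)
          obtain ⟨Y, y, hY, hyY, eY, hneY⟩ := hsph I hI i hiI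
          have hiy : i ≠ y := by
            rintro rfl
            apply hneY
            rw [← Finset.insert_erase hiI, eY, Finset.insert_erase hyY]
          have hyi : y < i := by
            rcases lt_or_ge i y with h | h
            · exact (v2 Y y hY hyY h eY).elim
            · exact lt_of_le_of_ne h hiy.symm
          obtain ⟨y1, y2, y3⟩ := flip_shape hiI hyY hiy eY
          have hay : a < y := by
            rcases lt_or_ge y a with h | h
            · exact (low i y Y hiI hY hyY hiy eY hai.le h).elim
            · refine lt_of_le_of_ne h ?_
              rintro rfl
              exact y1 haI
          have ry := flip_refl' cs Q hiI hyY hiy eY hI hY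
          have rx := flip_refl' cs Q hi hx hix.ne e' hK hK'
          obtain ⟨x1, x2, x3⟩ := flip_shape hi hx hix.ne e'
          rcases lt_or_ge j i with hji | hji
          · rw [c1 i hji, c1 x (hji.trans hix)] at rx
            have hxI : x ∉ I := fun h =>
              x1 ((s3 x (hai.trans hix).ne' (hji.trans hix).ne').1 h)
            have := refl_inj cs Q I hI y x y1 hxI (ry.symm.trans rx)
            exact absurd (this ▸ hyi.trans hix) (lt_irrefl _)
          · have hyj : y < j := hyi.trans_le hji
            have hyK : y ∉ K := fun h => y1 ((s3 y hay.ne' hyj.ne).2 h)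
            have r : scRefl cs Q K i = scRefl cs Q K y := by
              rw [c2 i hai hji, c2 y hay hyj.le, ry]
            have := refl_inj cs Q K hK y x hyK x1 (r.symm.trans rx)
            exact absurd (this ▸ hyi.trans hix) (lt_irrefl _))
    refine ⟨K :: l, DWalk.cons ⟨hI, hK, a, haI, j, hjK, hlt, e⟩ hw, ?_⟩
    have hIK : I \ K = {a} := by
      ext z
      simp only [Finset.mem_sdiff, Finset.mem_singleton]
      constructor
      · rintro ⟨h1, h2⟩
        by_contra hza
        have hzj : z ≠ j := by rintro rfl; exact s1 h1
        exact h2 ((s3 z hza hzj).1 h1)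
      · rintro rfl; exact ⟨haI, s2⟩
    have : wLabels pLab I (K :: l) = pLab I K :: wLabels pLab K l := rfl
    rw [this, hl, pLab, hIK]
    simp

end Helpers

/-- In a spherical subword complex, starting from the unique source facet `P` of the
increasing flip graph and successively flipping all positions of `P` in decreasing order
yields a well-defined path of increasing flips ending at the unique sink facet `N`;
in particular it is a positive-falling path from `P` to `N`. -/
theorem greedy_falling_path_source_to_sink {B W : Type*} [Group W] [Finite W]
    {M : CoxeterMatrix B} (cs : CoxeterSystem M W)
    {m : ℕ} (Q : Fin m → B) (ρ : W)
    -- sphericality: every position of every facet is flippable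
    (hsph : ∀ I : Finset (Fin m), IsSCFacet cs Q ρ I → ∀ i ∈ I,
      ∃ (J : Finset (Fin m)) (j : Fin m), IsSCFacet cs Q ρ J ∧ j ∈ J ∧
        I.erase i = J.erase j ∧ I ≠ J)
    -- `P` is the unique source and `N` the unique sink of the increasing flip graph
    (P N : Finset (Fin m))
    (hP : IsSCFacet cs Q ρ P ∧ ∀ J, ¬FlipEdge cs Q ρ J P)
    (hPuniq : ∀ I, IsSCFacet cs Q ρ I → (∀ J, ¬FlipEdge cs Q ρ J I) → I = P)
    (hN : IsSCFacet cs Q ρ N ∧ ∀ J, ¬FlipEdge cs Q ρ N J)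
    (hNuniq : ∀ I, IsSCFacet cs Q ρ I → (∀ J, ¬FlipEdge cs Q ρ I J) → I = N) :
    ∃ l : List (Finset (Fin m)),
      DWalk (FlipEdge cs Q ρ) P N l ∧
      wLabels pLab P l = ((P.sort (· ≤ ·)).map Fin.val).reverse ∧
      List.Chain' (· ≥ ·) (wLabels pLab P l) := by
  have hs : ((P.sort (· ≤ ·)).reverse).Pairwise (· > ·) := by
    rw [List.pairwise_reverse]
    exact Finset.sortedLT_sort P |>.pairwise
  obtain ⟨l, h1, h2⟩ := greedy_aux cs Q hsph P N hPuniq hNuniq (P.sort (· ≤ ·)).reverse hs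
    (fun p hp hp' => absurd (by simpa using hp) hp') P hP.1 (fun q hq => by simpa using hq)
    (fun i hi hi' => absurd (by simpa using hi) hi')
  refine ⟨l, h1, by rw [h2, List.map_reverse], ?_⟩
  rw [h2]
  apply List.Pairwise.isChain
  rw [List.pairwise_map]
  exact hs.imp (fun h => le_of_lt h)
end
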